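/- arXiv:1809.01514 — 2 statements merged into one kernel-verified Lean document; each statement's English description precedes it below -/
import Mathlib

section
/- For all partitions λ, μ, ν, and for all integers d ≥ (3|ν| − |λ| − |μ| − λ₁ − μ₁ − ν₁ + λ₂ + μ₂ + ν₂ − 1)/2, the Aguiar coefficients satisfy a_{λ+(d), μ+(d)}^{ν+(d)} = a_{λ+(d+1), μ+(d+1)}^{ν+(d+1)}; that is, the sequence d ↦ a_{λ+(d),μ+(d)}^{ν+(d)} is constant for d at least this bound. -/
open scoped BigOperators
open scoped Classical

/-- A partition: a finitely supported antitone sequence of natural numbers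
(the parts, indexed from 0). -/
def IsPartitionFun (f : ℕ →₀ ℕ) : Prop := ∀ ⦃i j : ℕ⦄, i ≤ j → f j ≤ f i

def Partition' : Type := {f : ℕ →₀ ℕ // IsPartitionFun f}

namespace Partition'

/-- The size `|λ|` of a partition. -/
def size (l : Partition') : ℕ := l.1.sum fun _ v => v

/-- The number of (nonzero) parts of a partition. -/
def plength (l : Partition') : ℕ := l.1.support.card

noncomputable instance : Add Partition' :=
  ⟨fun l m => ⟨l.1 + m.1, fun i j h => by
    simp only [Finsupp.add_apply]
    exact add_le_add (l.2 h) (m.2 h)⟩⟩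

noncomputable instance : SMul ℕ Partition' :=
  ⟨fun d l => ⟨d • l.1, fun i j h => by
    simp only [Finsupp.smul_apply, smul_eq_mul]
    exact Nat.mul_le_mul_left d (l.2 h)⟩⟩

/-- The one-row partition `(m)`. For `m = 0` this is the empty partition. -/
noncomputable def row (m : ℕ) : Partition' :=
  ⟨Finsupp.single 0 m, by
    intro i j h
    simp only [Finsupp.single_apply]
    split_ifs <;> omega⟩

/-- The two-row partition `(a, b)` (with `b ≤ a`). -/
noncomputable def twoRow (a b : ℕ) (hba : b ≤ a) : Partition' :=
  ⟨Finsupp.single 0 a + Finsupp.single 1 b, by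
    intro i j h
    simp only [Finsupp.add_apply, Finsupp.single_apply]
    split_ifs <;> omega⟩

/-- `youngCount n a g` is the number of fixed points of the permutation `g` acting on the
set of functions `Fin n → Fin n` whose fibre over `i` has exactly `a i` elements; i.e. the
value at `g` of the permutation character of `S_n` acting on cosets of the Young subgroup
attached to the composition `a`. It is `0` if some `a i` is negative. -/
noncomputable def youngCount (n : ℕ) (a : Fin n → ℤ) (g : Equiv.Perm (Fin n)) : ℤ :=
  if ∀ i, 0 ≤ a i then
    (Nat.card {f : Fin n → Fin n //
      f ∘ g = f ∧ ∀ i : Fin n, Nat.card {x : Fin n // f x = i} = (a i).toNat} : ℤ)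
  else 0

/-- The irreducible character of the symmetric group `S_n` attached to a partition `l`
of `n`, given by the Jacobi–Trudi determinantal formula
`χ_l = det (h_{l_i - i + j})` expanded over permutations, where `h`-products are the
permutation characters of Young subgroups. (When `size l ≠ n` this is not used.) -/
noncomputable def irrChar (n : ℕ) (l : Partition') (g : Equiv.Perm (Fin n)) : ℤ :=
  ∑ σ : Equiv.Perm (Fin n), (Equiv.Perm.sign σ : ℤ) *
    youngCount n (fun i => (l.1 i : ℤ) + ((σ i : ℕ) : ℤ) - (i : ℤ)) g

/-- The Kronecker coefficient `g_{λ,μ,ν}`: the multiplicity of the irreducible `S_n`-module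
`M_ν` in `M_λ ⊗ M_μ` (for `|λ| = |μ| = |ν| = n`), computed as the scalar product of
characters `(1/n!) ∑_{g ∈ S_n} χ_λ(g) χ_μ(g) χ_ν(g)`; it is `0` if the sizes differ. -/
noncomputable def kron (l m nu : Partition') : ℕ :=
  if size l = size nu ∧ size m = size nu then
    ((∑ g : Equiv.Perm (Fin (size nu)),
        irrChar (size nu) l g * irrChar (size nu) m g * irrChar (size nu) nu g) /
      (Nat.factorial (size nu) : ℤ)).toNat
  else 0

/-- The standard embedding `S_a × S_b ↪ S_{a+b}`. -/
def sumEmb {a b : ℕ} (g : Equiv.Perm (Fin a)) (h : Equiv.Perm (Fin b)) :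
    Equiv.Perm (Fin (a + b)) :=
  (Equiv.permCongr finSumFinEquiv) (Equiv.sumCongr g h)

/-- The Littlewood–Richardson coefficient `c_{λ,μ}^ν`: the multiplicity of `M_ν` in the
induction of `M_λ ⊠ M_μ` from `S_{|λ|} × S_{|μ|}` to `S_{|λ|+|μ|}`, computed by
Frobenius reciprocity as a scalar product of characters; it is `0` unless
`|ν| = |λ| + |μ|`. -/
noncomputable def lr (l m nu : Partition') : ℕ :=
  if size nu = size l + size m then
    ((∑ g : Equiv.Perm (Fin (size l)), ∑ h : Equiv.Perm (Fin (size m)),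
        irrChar (size l) l g * irrChar (size m) m h *
          irrChar (size l + size m) nu (sumEmb g h)) /
      ((Nat.factorial (size l) : ℤ) * (Nat.factorial (size m) : ℤ))).toNat
  else 0

/-- The Aguiar coefficient `a_{λ,μ}^ν`, defined by
`a_{λ,μ}^ν = Σ_{α,β,δ,η,ρ,τ} c_{α,β}^λ c_{η,ρ}^μ g_{β,η,δ} c_{α,δ}^τ c_{τ,ρ}^ν`. -/
noncomputable def aguiar (l m nu : Partition') : ℕ :=
  ∑ᶠ (α : Partition') (β : Partition') (δ : Partition') (η : Partition')
    (ρ : Partition') (τ : Partition'),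
    lr α β l * lr η ρ m * kron β η δ * lr α δ τ * lr τ ρ nu

end Partition'


open scoped BigOperators
open scoped Classical

namespace AgS

noncomputable def geo {R : Type*} [CommRing R] (w : R) : PowerSeries R := PowerSeries.mk fun k => w ^ k

noncomputable def hh {S R : Type*} [CommRing R] (s : Finset S) (w : S → R) (n : ℕ) : R :=
  PowerSeries.coeff n (∏ i ∈ s, geo (w i))

noncomputable def Pg {S R : Type*} [Fintype S] [CommRing R] {n : ℕ} (w : S → R)
    (g : Equiv.Perm (Fin n)) : R :=
  ∑ f : Fin n → S, if f ∘ g = f then ∏ i, w (f i) else 0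

/-- content of a function -/
noncomputable def cont {S : Type*} [Fintype S] {n : ℕ} (f : Fin n → S) : S →₀ ℕ :=
  Finsupp.equivFunOnFinite.symm fun s => Fintype.card {i // f i = s}

theorem cont_apply {S : Type*} [Fintype S] {n : ℕ} (f : Fin n → S) (s : S) :
    cont f s = Fintype.card {i // f i = s} := rfl

theorem prod_cont {S R : Type*} [Fintype S] [CommRing R] {n : ℕ} (w : S → R) (f : Fin n → S) :
    ∏ i, w (f i) = ∏ s, w s ^ cont f s := by
  rw [← Finset.prod_fiberwise (s := Finset.univ) (g := f)]
  refine Finset.prod_congr rfl fun s _ => ?_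
  rw [Finset.prod_congr rfl (g := fun _ => w s)]
  · rw [Finset.prod_const, cont_apply, Fintype.card_subtype]
  · intro i hi
    rw [(Finset.mem_filter.1 hi).2]

theorem cont_mem {S : Type*} [Fintype S] {n : ℕ} (f : Fin n → S) :
    cont f ∈ Finset.finsuppAntidiag (Finset.univ : Finset S) n := by
  rw [Finset.mem_finsuppAntidiag]
  refine ⟨?_, Finset.subset_univ _⟩
  have := Fintype.card_congr (Equiv.sigmaFiberEquiv f)
  rw [Fintype.card_sigma, Fintype.card_fin] at this
  exact this

theorem cont_card {S : Type*} [Fintype S] {n : ℕ} (f : Fin n → S) (s : S) :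
    cont f s = Nat.card {i // f i = s} := by
  rw [cont_apply, Nat.card_eq_fintype_card]

theorem cont_sum {S : Type*} [Fintype S] {n : ℕ} (f : Fin n → S) : ∑ s, cont f s = n :=
  (Finset.mem_finsuppAntidiag.1 (cont_mem f)).1

theorem exists_cont {S : Type*} [Fintype S] {n : ℕ} (m : S →₀ ℕ)
    (hm : m ∈ Finset.finsuppAntidiag (Finset.univ : Finset S) n) : ∃ f : Fin n → S, cont f = m := by
  rw [Finset.mem_finsuppAntidiag] at hm
  have hc : Fintype.card (Fin n) = Fintype.card (Σ s, Fin (m s)) := by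
    rw [Fintype.card_sigma, Fintype.card_fin, ← hm.1]
    exact Finset.sum_congr rfl fun s _ => by simp
  let e := Fintype.equivOfCardEq hc
  refine ⟨fun i => (e i).1, ?_⟩
  ext s
  rw [cont_apply]
  have : {i // (e i).1 = s} ≃ Fin (m s) :=
    (Equiv.subtypeEquiv (p := fun i => (e i).1 = s) (q := fun x : Σ s, Fin (m s) => x.1 = s) e
      (fun i => Iff.rfl)).trans (Equiv.sigmaSubtype (β := fun s => Fin (m s)) s)
  rw [Fintype.card_congr this, Fintype.card_fin]

theorem exists_perm {S : Type*} [Fintype S] {n : ℕ} (f f' : Fin n → S) (h : cont f = cont f') :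
    ∃ g : Equiv.Perm (Fin n), f' ∘ g = f := by
  have hs : ∀ s, Nonempty ({i // f i = s} ≃ {i // f' i = s}) := fun s => by
    have := DFunLike.congr_fun h s
    rw [cont_apply, cont_apply] at this
    exact ⟨Fintype.equivOfCardEq this⟩
  have e := fun s => (hs s).some
  refine ⟨(Equiv.sigmaFiberEquiv f).symm.trans ((Equiv.sigmaCongrRight fun s => e s).trans
    (Equiv.sigmaFiberEquiv f')), ?_⟩
  ext i
  exact (e (f i) ⟨i, rfl⟩).2

theorem cont_comp {S : Type*} [Fintype S] {n : ℕ} (f : Fin n → S) (g : Equiv.Perm (Fin n)) :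
    cont (f ∘ g) = cont f := by
  ext s
  rw [cont_apply, cont_apply]
  exact Fintype.card_congr (Equiv.subtypeEquiv g fun i => Iff.rfl)

theorem burn {S : Type*} [Fintype S] {n : ℕ} (m : S →₀ ℕ)
    (hm : m ∈ Finset.finsuppAntidiag (Finset.univ : Finset S) n) :
    ∑ f : Fin n → S with cont f = m,
      (Finset.univ.filter fun g : Equiv.Perm (Fin n) => f ∘ g = f).card = n.factorial := by
  obtain ⟨f0, rfl⟩ := exists_cont m hm
  have h1 : ∀ f ∈ Finset.univ.filter (fun f : Fin n → S => cont f = cont f0),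
      (Finset.univ.filter fun g : Equiv.Perm (Fin n) => f ∘ g = f).card =
      (Finset.univ.filter fun g : Equiv.Perm (Fin n) => f0 ∘ g = f).card := by
    intro f hf
    obtain ⟨k, rfl⟩ := exists_perm f f0 (Finset.mem_filter.1 hf).2
    refine Finset.card_bij (fun g _ => k * g) ?_ ?_ ?_
    · intro g hg
      simpa [Function.comp_assoc] using hg
    · intro a _ b _ h
      simpa using h
    · intro g hg
      refine ⟨k⁻¹ * g, ?_, by simp⟩
      rw [Finset.mem_filter] at hg ⊢
      refine ⟨Finset.mem_univ _, ?_⟩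
      rw [← hg.2]
      conv_lhs => rw [hg.2]
      ext i
      simp
  rw [Finset.sum_congr rfl h1, ← Finset.card_eq_sum_card_fiberwise (f := fun g : Equiv.Perm (Fin n) => f0 ∘ g)
    (s := Finset.univ)]
  · rw [Finset.card_univ, Fintype.card_perm, Fintype.card_fin]
  · intro g _
    simp [cont_comp]

theorem hh_eq {S R : Type*} [CommRing R] (s : Finset S) (w : S → R) (n : ℕ) :
    hh s w n = ∑ m ∈ Finset.finsuppAntidiag s n, ∏ i ∈ s, w i ^ m i := by
  rw [hh, PowerSeries.coeff_prod]
  simp [geo]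

theorem sum_Pg {S R : Type*} [Fintype S] [CommRing R] (n : ℕ) (w : S → R) :
    ∑ g : Equiv.Perm (Fin n), Pg w g = (n.factorial : R) * hh Finset.univ w n := by
  unfold Pg
  rw [Finset.sum_comm, hh_eq, Finset.mul_sum]
  rw [← Finset.sum_fiberwise_of_maps_to (s := Finset.univ) (fun f _ => cont_mem f)]
  refine Finset.sum_congr rfl fun m hm => ?_
  rw [← burn m hm, Nat.cast_sum, Finset.sum_mul]
  refine Finset.sum_congr rfl fun f hf => ?_
  rw [← Finset.sum_filter, Finset.sum_const, prod_cont, (Finset.mem_filter.1 hf).2, nsmul_eq_mul]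

theorem Pg_mul {S S' R : Type*} [Fintype S] [Fintype S'] [CommRing R] {n : ℕ} (w : S → R) (w' : S' → R)
    (g : Equiv.Perm (Fin n)) :
    Pg w g * Pg w' g = Pg (fun p : S × S' => w p.1 * w' p.2) g := by
  unfold Pg
  rw [Finset.sum_mul_sum, ← Fintype.sum_prod_type']
  refine (Fintype.sum_equiv (Equiv.arrowProdEquivProdArrow (Fin n) (fun _ => S) (fun _ => S')) _ _ ?_).symm
  intro f
  have : f ∘ g = f ↔ (fun i => (f i).1) ∘ g = (fun i => (f i).1) ∧
      (fun i => (f i).2) ∘ g = (fun i => (f i).2) := by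
    simp only [funext_iff, Function.comp_apply, Prod.ext_iff, forall_and]
  simp only [Equiv.arrowProdEquivProdArrow, Equiv.coe_fn_mk, this, Finset.prod_mul_distrib]
  split_ifs <;> simp_all

theorem Pg_sumEmb {S R : Type*} [Fintype S] [CommRing R] {a b : ℕ} (w : S → R)
    (g : Equiv.Perm (Fin a)) (h : Equiv.Perm (Fin b)) :
    Pg w (Partition'.sumEmb g h) = Pg w g * Pg w h := by
  unfold Pg
  rw [Finset.sum_mul_sum, ← Fintype.sum_prod_type']
  refine Fintype.sum_equiv ((Equiv.arrowCongr finSumFinEquiv.symm (Equiv.refl S)).trans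
    (Equiv.sumArrowEquivProdArrow _ _ _)) _ _ ?_
  intro f
  have : f ∘ (Partition'.sumEmb g h) = f ↔
      (fun i => f (finSumFinEquiv (Sum.inl i))) ∘ g = (fun i => f (finSumFinEquiv (Sum.inl i))) ∧
      (fun i => f (finSumFinEquiv (Sum.inr i))) ∘ h = (fun i => f (finSumFinEquiv (Sum.inr i))) := by
    simp only [funext_iff, Function.comp_apply]
    rw [← finSumFinEquiv.forall_congr_right, Sum.forall]
    simp [Partition'.sumEmb, Equiv.permCongr_apply, -finSumFinEquiv_apply_left, -finSumFinEquiv_apply_right]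
  have h2 : ∏ i, w (f i) = (∏ i, w (f (finSumFinEquiv (Sum.inl i)))) * ∏ i, w (f (finSumFinEquiv (Sum.inr i))) := by
    rw [← Fintype.prod_sum_type (fun x => w (f (finSumFinEquiv x)))]
    exact (Equiv.prod_comp finSumFinEquiv (fun x => w (f x))).symm
  have e1 : ((Equiv.arrowCongr finSumFinEquiv.symm (Equiv.refl S)).trans
    (Equiv.sumArrowEquivProdArrow _ _ _)) f = (fun i => f (finSumFinEquiv (Sum.inl i)), fun i => f (finSumFinEquiv (Sum.inr i))) := by
    ext i <;> simp [Equiv.sumArrowEquivProdArrow]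
  simp only [this, e1, h2]
  split_ifs <;> simp_all

theorem Pg_map {S R R' : Type*} [Fintype S] [CommRing R] [CommRing R'] {n : ℕ} (φ : R →+* R') (w : S → R)
    (g : Equiv.Perm (Fin n)) : φ (Pg w g) = Pg (fun s => φ (w s)) g := by
  unfold Pg
  rw [map_sum]
  refine Finset.sum_congr rfl fun f _ => ?_
  split_ifs <;> simp

theorem Pg_inv {S R : Type*} [Fintype S] [CommRing R] {n : ℕ} (w : S → R)
    (g : Equiv.Perm (Fin n)) : Pg w g⁻¹ = Pg w g := by
  unfold Pg
  refine Finset.sum_congr rfl fun f _ => ?_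
  have : f ∘ (g⁻¹ : Equiv.Perm (Fin n)) = f ↔ f ∘ g = f := by
    constructor
    · intro h
      conv_lhs => rw [← h]
      ext i; simp
    · intro h
      conv_lhs => rw [← h]
      ext i; simp
  simp only [this]

theorem hh_union {S R : Type*} [CommRing R] (s t : Finset S) (hst : Disjoint s t) (w : S → R) (n : ℕ) :
    hh (s ∪ t) w n = ∑ p ∈ Finset.HasAntidiagonal.antidiagonal n, hh s w p.1 * hh t w p.2 := by
  rw [hh, Finset.prod_union hst, PowerSeries.coeff_mul]; rfl

theorem hh_smul {S R : Type*} [CommRing R] (s : Finset S) (c : R) (w : S → R) (n : ℕ) :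
    hh s (fun i => c * w i) n = c ^ n * hh s w n := by
  rw [hh_eq, hh_eq, Finset.mul_sum]
  refine Finset.sum_congr rfl fun m hm => ?_
  simp only [mul_pow, Finset.prod_mul_distrib, Finset.prod_pow_eq_pow_sum]
  rw [(Finset.mem_finsuppAntidiag.1 hm).1]

theorem hh_map {S R R' : Type*} [CommRing R] [CommRing R'] (φ : R →+* R') (s : Finset S) (w : S → R)
    (n : ℕ) : φ (hh s w n) = hh s (fun i => φ (w i)) n := by
  rw [hh_eq, hh_eq, map_sum]
  simp

theorem hh_zero {S R : Type*} [CommRing R] (s : Finset S) (w : S → R) : hh s w 0 = 1 := by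
  rw [hh_eq]; simp

theorem geo_mul {R : Type*} [CommRing R] (w : R) :
    geo w * (1 - PowerSeries.C w * PowerSeries.X) = 1 := by
  have := PowerSeries.mk_one_mul_one_sub_eq_one R
  have h2 := congrArg (PowerSeries.rescale w) this
  simp only [map_mul, map_one, map_sub] at h2
  convert h2 using 2
  · ext n; simp [geo, PowerSeries.coeff_rescale]
  · ext n; simp [PowerSeries.coeff_X]

end AgS

open scoped BigOperators
open scoped Classical

namespace AgS

def dl (N : ℕ) (i : Fin N) : ℕ := N - 1 - i

noncomputable def alt {R : Type*} [CommRing R] {N : ℕ} (w : Fin N → R) (α : Fin N → ℕ) : R :=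
  Matrix.det (Matrix.of fun i k => w k ^ α i)

noncomputable def JTm {S R : Type*} [Fintype S] [CommRing R] {N : ℕ} (w : S → R) (α : Fin N → ℕ) :
    Matrix (Fin N) (Fin N) R :=
  Matrix.of fun i j => if dl N j ≤ α i then hh Finset.univ w (α i - dl N j) else 0

noncomputable def sch {S R : Type*} [Fintype S] [CommRing R] {N : ℕ} (w : S → R) (α : Fin N → ℕ) : R :=
  (JTm w α).det

theorem alt_apply {R : Type*} [CommRing R] {N : ℕ} (w : Fin N → R) (α : Fin N → ℕ) :
    alt w α = ∑ σ : Equiv.Perm (Fin N), ((Equiv.Perm.sign σ : ℤ) : R) * ∏ i, w i ^ α (σ i) := by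
  rw [alt, Matrix.det_apply']
  rfl

theorem sch_apply {S R : Type*} [Fintype S] [CommRing R] {N : ℕ} (w : S → R) (α : Fin N → ℕ) :
    sch w α = ∑ σ : Equiv.Perm (Fin N), ((Equiv.Perm.sign σ : ℤ) : R) *
      ∏ i, if dl N (σ i) ≤ α i then hh Finset.univ w (α i - dl N (σ i)) else 0 := by
  rw [sch, ← Matrix.det_transpose, Matrix.det_apply']
  rfl

noncomputable def ec {R : Type*} [CommRing R] {N : ℕ} (w : Fin N → R) (k : Fin N) (m : ℕ) : R :=
  PowerSeries.coeff m (∏ l ∈ Finset.univ.erase k, (1 - PowerSeries.C (w l) * PowerSeries.X))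

theorem coeff_prod_lin {S R : Type*} [CommRing R] (s : Finset S) (w : S → R) (m : ℕ) (hm : s.card < m) :
    PowerSeries.coeff m (∏ l ∈ s, (1 - PowerSeries.C (w l) * PowerSeries.X)) = 0 := by
  induction s using Finset.induction_on generalizing m with
  | empty =>
    simp only [Finset.prod_empty, PowerSeries.coeff_one]
    rw [if_neg]; simp at hm; omega
  | insert a s ha ih =>
    rw [Finset.prod_insert ha]
    rw [Finset.card_insert_of_notMem ha] at hm
    obtain ⟨m, rfl⟩ : ∃ k, m = k + 1 := ⟨m - 1, by omega⟩
    rw [sub_mul, one_mul, map_sub, mul_assoc, PowerSeries.coeff_C_mul, PowerSeries.coeff_succ_X_mul,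
      ih _ (by omega), ih _ (by omega)]
    simp

theorem pow_eq {R : Type*} [CommRing R] {N : ℕ} (w : Fin N → R) (k : Fin N) (s : ℕ) :
    w k ^ s = ∑ j : Fin N, (if dl N j ≤ s then hh Finset.univ w (s - dl N j) else 0) * ec w k (dl N j) := by
  have h1 : geo (w k) = (∏ i, geo (w i)) * ∏ l ∈ Finset.univ.erase k, (1 - PowerSeries.C (w l) * PowerSeries.X) := by
    rw [← Finset.mul_prod_erase Finset.univ _ (Finset.mem_univ k), mul_assoc, ← Finset.prod_mul_distrib]
    simp [geo_mul]
  have h2 : w k ^ s = ∑ m ∈ Finset.range (s + 1), hh Finset.univ w (s - m) * ec w k m := by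
    have : w k ^ s = PowerSeries.coeff s (geo (w k)) := by simp [geo]
    rw [this, h1, mul_comm, PowerSeries.coeff_mul, Finset.Nat.sum_antidiagonal_eq_sum_range_succ_mk]
    refine Finset.sum_congr rfl fun m _ => ?_
    rw [mul_comm]; rfl
  have h3 : ∀ m, N ≤ m → ec w k m = 0 := fun m hm => by
    apply coeff_prod_lin
    rw [Finset.card_erase_of_mem (Finset.mem_univ _), Finset.card_univ, Fintype.card_fin]
    have := k.2
    omega
  have h4 : ∑ j : Fin N, (if dl N j ≤ s then hh Finset.univ w (s - dl N j) else 0) * ec w k (dl N j)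
      = ∑ m ∈ Finset.range N, (if m ≤ s then hh Finset.univ w (s - m) else 0) * ec w k m := by
    rw [← Fin.sum_univ_eq_sum_range (fun m => (if m ≤ s then hh Finset.univ w (s - m) else 0) * ec w k m)]
    refine Fintype.sum_equiv Fin.revPerm _ _ fun j => ?_
    have : ((Fin.revPerm j : Fin N) : ℕ) = dl N j := by
      simp [dl, Fin.val_rev]; omega
    rw [this]
  rw [h4, h2]
  have h5 : ∀ m, (if m ≤ s then hh Finset.univ w (s - m) else 0) * ec w k m =
    if m < s + 1 then hh Finset.univ w (s - m) * ec w k m else 0 := fun m => by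
    split_ifs <;> first | rfl | omega | simp
  simp only [h5]
  rw [← Finset.sum_filter]
  symm
  refine Finset.sum_subset ?_ ?_
  · intro m; simp
  · intro m hm hm'
    simp at hm hm'
    rw [h3 m (by omega), mul_zero]

theorem alt_eq {R : Type*} [CommRing R] {N : ℕ} (w : Fin N → R) (α : Fin N → ℕ) :
    alt w α = alt w (dl N) * sch w α := by
  have key : ∀ β : Fin N → ℕ, (Matrix.of fun i k => w k ^ β i) =
      JTm w β * Matrix.of fun j k => ec w k (dl N j) := by
    intro β
    ext i k
    rw [Matrix.mul_apply]
    exact pow_eq w k (β i)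
  have h1 : sch w (dl N) = 1 := by
    rw [sch, Matrix.det_of_isUpperTriangular]
    · refine Finset.prod_eq_one fun i _ => ?_
      simp [JTm, hh_zero]
    · intro i j hij
      have hij : j < i := hij
      simp only [JTm, Matrix.of_apply]
      rw [if_neg]
      simp only [dl]
      have := i.2
      have : (j : ℕ) < i := hij
      omega
  have h2 : ∀ β : Fin N → ℕ, alt w β = sch w β * Matrix.det (Matrix.of fun j k => ec w k (dl N j)) := by
    intro β
    rw [alt, key, Matrix.det_mul]; rfl
  rw [h2 α, h2 (dl N), h1]
  ring

/-- exponents as a finsupp -/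
noncomputable def fs {N : ℕ} (e : Fin N → ℕ) : Fin N →₀ ℕ := Finsupp.equivFunOnFinite.symm e

theorem fs_apply {N : ℕ} (e : Fin N → ℕ) (i) : fs e i = e i := rfl

theorem fs_inj {N : ℕ} {e e' : Fin N → ℕ} : fs e = fs e' ↔ e = e' :=
  Finsupp.equivFunOnFinite.symm.injective.eq_iff

theorem prod_X_pow {K : Type*} [CommRing K] {N : ℕ} (e : Fin N → ℕ) :
    ∏ i, (MvPolynomial.X i : MvPolynomial (Fin N) K) ^ e i = MvPolynomial.monomial (fs e) 1 := by
  rw [MvPolynomial.monomial_eq, Finsupp.prod_fintype]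
  · simp [fs_apply]
  · simp

noncomputable def Lf {K : Type*} [CommRing K] {N : ℕ} (α : Fin N → ℕ) : MvPolynomial (Fin N) K →ₗ[K] K :=
  (MvPolynomial.lcoeff K (fs α)).comp (LinearMap.mulLeft K (alt MvPolynomial.X (dl N)))

theorem Lf_apply {K : Type*} [CommRing K] {N : ℕ} (α : Fin N → ℕ) (f : MvPolynomial (Fin N) K) :
    Lf α f = MvPolynomial.coeff (fs α) (alt MvPolynomial.X (dl N) * f) := rfl

theorem alt_map {R R' : Type*} [CommRing R] [CommRing R'] {N : ℕ} (φ : R →+* R') (w : Fin N → R) (α : Fin N → ℕ) :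
    φ (alt w α) = alt (fun i => φ (w i)) α := by
  simp [alt_apply]

theorem sch_map {S R R' : Type*} [Fintype S] [CommRing R] [CommRing R'] {N : ℕ} (φ : R →+* R') (w : S → R) (α : Fin N → ℕ) :
    φ (sch w α) = sch (fun i => φ (w i)) α := by
  simp only [sch_apply, map_sum, map_mul, map_intCast, map_prod]
  refine Finset.sum_congr rfl fun σ _ => ?_
  congr 1
  refine Finset.prod_congr rfl fun i _ => ?_
  split_ifs
  · rw [hh_map]
  · simp

theorem Lf_map {K K' : Type*} [CommRing K] [CommRing K'] {N : ℕ} (φ : K →+* K') (α : Fin N → ℕ)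
    (f : MvPolynomial (Fin N) K) : φ (Lf α f) = Lf α (MvPolynomial.map φ f) := by
  rw [Lf_apply, Lf_apply, ← MvPolynomial.coeff_map, map_mul, alt_map]
  simp

theorem Lf_eq {K : Type*} [CommRing K] {N : ℕ} (α : Fin N → ℕ) (f : MvPolynomial (Fin N) K) :
    Lf α f = ∑ σ : Equiv.Perm (Fin N), ((Equiv.Perm.sign σ : ℤ) : K) *
      if ∀ i, dl N (σ i) ≤ α i then MvPolynomial.coeff (fs fun i => α i - dl N (σ i)) f else 0 := by
  rw [Lf_apply, alt_apply, Finset.sum_mul, MvPolynomial.coeff_sum]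
  refine Finset.sum_congr rfl fun σ _ => ?_
  have : (((Equiv.Perm.sign σ : ℤ) : MvPolynomial (Fin N) K)) = MvPolynomial.C ((Equiv.Perm.sign σ : ℤ) : K) := by simp
  rw [prod_X_pow (fun i => dl N (σ i)), mul_assoc, this, MvPolynomial.coeff_C_mul, MvPolynomial.coeff_monomial_mul', one_mul]
  congr 1
  have h1 : fs (fun i => dl N (σ i)) ≤ fs α ↔ ∀ i, dl N (σ i) ≤ α i := Iff.rfl
  have h2 : fs α - fs (fun i => dl N (σ i)) = fs fun i => α i - dl N (σ i) := by ext i; rfl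
  simp only [h1, h2]

theorem fs_coe {N : ℕ} (m : Fin N →₀ ℕ) : fs (m : Fin N → ℕ) = m := by ext i; rfl

theorem hh_prod {K : Type*} [CommRing K] {S : Type*} [Fintype S] {N : ℕ} (w : S → K) (n : ℕ) :
    hh Finset.univ (fun p : Fin N × S => (MvPolynomial.X p.1 : MvPolynomial (Fin N) K) * MvPolynomial.C (w p.2)) n =
    ∑ m ∈ Finset.finsuppAntidiag Finset.univ n, MvPolynomial.monomial m (∏ i, hh Finset.univ w (m i)) := by
  have h1 : ∀ i : Fin N, ∏ j, geo ((MvPolynomial.X i : MvPolynomial (Fin N) K) * MvPolynomial.C (w j)) =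
      PowerSeries.mk fun k => (MvPolynomial.X i : MvPolynomial (Fin N) K) ^ k * MvPolynomial.C (hh Finset.univ w k) := by
    intro i
    ext1 k
    rw [PowerSeries.coeff_mk, ← hh, hh_smul, hh_map]
  rw [hh, Fintype.prod_prod_type]
  simp only [h1]
  rw [PowerSeries.coeff_prod]
  refine Finset.sum_congr rfl fun m _ => ?_
  simp only [PowerSeries.coeff_mk]
  rw [Finset.prod_mul_distrib, prod_X_pow, ← map_prod, mul_comm, MvPolynomial.C_mul_monomial, mul_one, fs_coe]

theorem sum_Lf_Pg {K : Type*} [CommRing K] {S : Type*} [Fintype S] {N n : ℕ} (w : S → K) (α : Fin N → ℕ)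
    (hα : ∑ i, α i = n + ∑ i, dl N i) :
    ∑ g : Equiv.Perm (Fin n), Lf α (Pg (MvPolynomial.X : Fin N → MvPolynomial (Fin N) K) g) * Pg w g
      = n.factorial * sch w α := by
  have h1 : ∀ g : Equiv.Perm (Fin n), Lf α (Pg (MvPolynomial.X : Fin N → MvPolynomial (Fin N) K) g) * Pg w g
     = Lf α (Pg (fun p : Fin N × S => (MvPolynomial.X p.1 : MvPolynomial (Fin N) K) * MvPolynomial.C (w p.2)) g) := by
    intro g
    rw [← Pg_mul MvPolynomial.X (fun s => MvPolynomial.C (w s)), ← Pg_map, mul_comm, mul_comm (Pg MvPolynomial.X g),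
      ← MvPolynomial.smul_eq_C_mul, map_smul, smul_eq_mul]
  simp only [h1]
  rw [← map_sum, sum_Pg, ← nsmul_eq_mul, map_nsmul, nsmul_eq_mul, hh_prod]
  congr 1
  rw [Lf_eq, sch_apply]
  refine Finset.sum_congr rfl fun σ _ => ?_
  congr 1
  split_ifs with h
  · rw [MvPolynomial.coeff_sum, Finset.sum_eq_single (fs fun i => α i - dl N (σ i))]
    · rw [MvPolynomial.coeff_monomial, if_pos rfl]
      refine Finset.prod_congr rfl fun i _ => ?_
      rw [if_pos (h i)]; rfl
    · intro m _ hm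
      rw [MvPolynomial.coeff_monomial, if_neg hm]
    · intro hm
      exfalso
      apply hm
      rw [Finset.mem_finsuppAntidiag]
      refine ⟨?_, Finset.subset_univ _⟩
      have h2 : ∑ i, dl N (σ i) = ∑ i, dl N i := Equiv.sum_comp σ (dl N)
      have h3 : ∑ i, (α i - dl N (σ i)) + ∑ i, dl N (σ i) = ∑ i, α i := by
        rw [← Finset.sum_add_distrib]
        exact Finset.sum_congr rfl fun i _ => Nat.sub_add_cancel (h i)
      have : ∑ i, fs (fun i => α i - dl N (σ i)) i = ∑ i, (α i - dl N (σ i)) := rfl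
      rw [this]
      omega
  · push Not at h
    obtain ⟨i, hi⟩ := h
    symm
    apply Finset.prod_eq_zero (Finset.mem_univ i)
    rw [if_neg (by omega)]

end AgS

open scoped BigOperators
open scoped Classical

namespace AgS
open Partition'

/-- shifted exponents of a partition -/
def pe (N : ℕ) (l : Partition') (i : Fin N) : ℕ := l.1 i + dl N i

theorem sum_range_le_size (l : Partition') (N : ℕ) : ∑ i ∈ Finset.range N, l.1 i ≤ size l := by
  rw [size, Finsupp.sum]
  calc ∑ i ∈ Finset.range N, l.1 i ≤ ∑ i ∈ Finset.range N ∪ l.1.support, l.1 i :=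
        Finset.sum_le_sum_of_subset Finset.subset_union_left
    _ = ∑ i ∈ l.1.support, l.1 i := by
        symm
        apply Finset.sum_subset Finset.subset_union_right
        intro i _ hi
        simpa using hi

theorem part_eq_zero (l : Partition') (i : ℕ) (hi : size l ≤ i) : l.1 i = 0 := by
  by_contra h
  have h1 := sum_range_le_size l (i + 1)
  have h2 : ∑ j ∈ Finset.range (i + 1), 1 ≤ ∑ j ∈ Finset.range (i + 1), l.1 j := by
    apply Finset.sum_le_sum
    intro j hj
    have : l.1 i ≤ l.1 j := l.2 (by simp at hj; omega)
    omega
  simp at h2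
  omega

theorem size_eq_sum (l : Partition') (N : ℕ) (h : ∀ i, N ≤ i → l.1 i = 0) :
    ∑ i : Fin N, l.1 i = size l := by
  rw [Fin.sum_univ_eq_sum_range (fun i => l.1 i), size, Finsupp.sum]
  symm
  apply Finset.sum_subset
  · intro i hi
    simp at hi ⊢
    by_contra h'
    exact hi (h i (by omega))
  · intro i _ hi
    simpa using hi

theorem sum_pe (l : Partition') {N : ℕ} (h : size l ≤ N) :
    ∑ i, pe N l i = size l + ∑ i, dl N i := by
  rw [← size_eq_sum l N fun i hi => part_eq_zero l i (by omega), ← Finset.sum_add_distrib]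
  rfl

theorem pe_strictAnti (l : Partition') (N : ℕ) : StrictAnti (pe N l) := by
  intro i j hij
  have h1 : l.1 j ≤ l.1 i := l.2 (le_of_lt (Fin.lt_def.1 hij))
  have h2 := i.2
  have h3 := j.2
  have : (i : ℕ) < j := hij
  simp only [pe, dl]
  omega

theorem pe_inj {l m : Partition'} {N : ℕ} (hl : size l ≤ N) (hm : size m ≤ N) (h : pe N l = pe N m) : l = m := by
  apply Subtype.ext
  ext i
  by_cases hi : i < N
  · have := congrFun h ⟨i, hi⟩
    simpa [pe] using this
  · rw [part_eq_zero l i (by omega), part_eq_zero m i (by omega)]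

theorem strictAnti_perm {N : ℕ} {a b : Fin N → ℕ} (ha : StrictAnti a) (hb : StrictAnti b)
    (π : Equiv.Perm (Fin N)) (h : a = b ∘ π) : π = 1 := by
  have hm : StrictMono π := by
    intro i j hij
    have := ha hij
    rw [h] at this
    exact hb.lt_iff_gt.1 this
  have h1 : (π : Fin N → Fin N) = id := by
    have h2 := Subsingleton.elim (hm.orderIsoOfSurjective π π.surjective) (OrderIso.refl (Fin N))
    ext i
    have h3 := congrArg (fun e : Fin N ≃o Fin N => (e i : ℕ)) h2
    exact h3
  ext i
  simp [h1]

theorem finite_par (n : ℕ) : {l : Partition' | size l = n}.Finite := by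
  let F : {l : Partition' | size l = n} → (Fin n → Fin (n + 1)) := fun l i => ⟨l.1.1 i, by
    have h := sum_range_le_size l.1 (i + 1)
    rw [Finset.sum_range_succ, show size l.1 = n from l.2] at h
    omega⟩
  have : Function.Injective F := by
    intro l m h
    apply Subtype.ext
    apply Subtype.ext
    ext i
    by_cases hi : i < n
    · have := congrFun h ⟨i, hi⟩
      simpa [F] using this
    · rw [part_eq_zero l.1 i (by rw [show size l.1 = n from l.2]; omega),
        part_eq_zero m.1 i (by rw [show size m.1 = n from m.2]; omega)]
  exact Finite.of_injective F this

noncomputable def Par (n : ℕ) : Finset Partition' := (finite_par n).toFinset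

theorem mem_Par {n : ℕ} {l : Partition'} : l ∈ Par n ↔ size l = n := by
  simp [Par]

theorem Pg_X {K : Type*} [CommRing K] {N n : ℕ} (g : Equiv.Perm (Fin n)) :
    Pg (MvPolynomial.X : Fin N → MvPolynomial (Fin N) K) g =
    ∑ f : Fin n → Fin N, if f ∘ g = f then MvPolynomial.monomial (cont f) 1 else 0 := by
  unfold Pg
  refine Finset.sum_congr rfl fun f _ => ?_
  rw [prod_cont, prod_X_pow, fs_coe]
  congr!

theorem coeff_Pg {K : Type*} [CommRing K] {N n : ℕ} (g : Equiv.Perm (Fin n)) (e : Fin N → ℕ) :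
    MvPolynomial.coeff (fs e) (Pg (MvPolynomial.X : Fin N → MvPolynomial (Fin N) K) g) =
      (Nat.card {f : Fin n → Fin N // f ∘ g = f ∧ ∀ i, Nat.card {x // f x = i} = e i} : K) := by
  rw [Pg_X, MvPolynomial.coeff_sum, Nat.card_eq_fintype_card, Fintype.card_subtype, Finset.card_eq_sum_ones,
    Nat.cast_sum, Finset.sum_filter]
  refine Finset.sum_congr rfl fun f _ => ?_
  have h : cont f = fs e ↔ ∀ i, Nat.card {x // f x = i} = e i := by
    rw [DFunLike.ext_iff]
    simp only [cont_card, fs_apply]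
  by_cases h1 : f ∘ g = f
  · simp [h1, MvPolynomial.coeff_monomial, h]
  · simp [h1]

theorem coeff_Pg_sum {K : Type*} [CommRing K] {N n : ℕ} (g : Equiv.Perm (Fin n)) (e : Fin N → ℕ)
    (h : MvPolynomial.coeff (fs e) (Pg (MvPolynomial.X : Fin N → MvPolynomial (Fin N) K) g) ≠ 0) :
    ∑ i, e i = n := by
  rw [Pg_X, MvPolynomial.coeff_sum] at h
  obtain ⟨f, _, hf⟩ := Finset.exists_ne_zero_of_sum_ne_zero h
  have h2 : cont f = fs e := by
    by_contra hc
    apply hf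
    split_ifs <;> simp [MvPolynomial.coeff_monomial, hc]
  have := cont_sum f
  rw [h2] at this
  exact this

theorem Pg_comp {S S' R : Type*} [Fintype S] [Fintype S'] [CommRing R] {n : ℕ} (w : S → R) (τ : S' ≃ S)
    (g : Equiv.Perm (Fin n)) : Pg (fun i => w (τ i)) g = Pg w g := by
  unfold Pg
  refine Fintype.sum_equiv (Equiv.arrowCongr (Equiv.refl _) τ) _ _ fun f => ?_
  have : (τ ∘ f) ∘ g = τ ∘ f ↔ f ∘ g = f := by
    rw [Function.comp_assoc]
    exact τ.injective.comp_left.eq_iff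
  have e1 : (Equiv.arrowCongr (Equiv.refl _) τ) f = τ ∘ f := by ext; simp
  rw [e1]
  simp only [this, Function.comp_apply]

theorem coeff_Pg_comp {K : Type*} [CommRing K] {N n : ℕ} (g : Equiv.Perm (Fin n)) (e : Fin N → ℕ)
    (τ : Equiv.Perm (Fin N)) :
    MvPolynomial.coeff (fs (e ∘ τ)) (Pg (MvPolynomial.X : Fin N → MvPolynomial (Fin N) K) g) =
    MvPolynomial.coeff (fs e) (Pg (MvPolynomial.X : Fin N → MvPolynomial (Fin N) K) g) := by
  have h1 : MvPolynomial.rename τ (Pg (MvPolynomial.X : Fin N → MvPolynomial (Fin N) K) g) =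
      Pg (MvPolynomial.X : Fin N → MvPolynomial (Fin N) K) g := by
    have := Pg_map (MvPolynomial.rename (R := K) τ).toRingHom MvPolynomial.X g
    refine this.trans ?_
    simp only [AlgHom.toRingHom_eq_coe, RingHom.coe_coe, MvPolynomial.rename_X]
    exact Pg_comp MvPolynomial.X τ g
  rw [← MvPolynomial.coeff_rename_mapDomain τ τ.injective, h1]
  congr 1
  ext i
  rw [Finsupp.mapDomain_equiv_apply]
  simp [fs_apply]

theorem Lf_comp {K : Type*} [CommRing K] {N n : ℕ} (g : Equiv.Perm (Fin n)) (e : Fin N → ℕ)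
    (τ : Equiv.Perm (Fin N)) :
    Lf (e ∘ τ) (Pg (MvPolynomial.X : Fin N → MvPolynomial (Fin N) K) g) =
    ((Equiv.Perm.sign τ : ℤ) : K) * Lf e (Pg (MvPolynomial.X : Fin N → MvPolynomial (Fin N) K) g) := by
  rw [Lf_eq, Lf_eq, Finset.mul_sum]
  refine (Fintype.sum_equiv (Equiv.mulRight τ) _ _ fun σ => ?_).symm
  simp only [Equiv.coe_mulRight, Equiv.Perm.coe_mul, Function.comp_apply, Equiv.Perm.sign_mul, Units.val_mul,
    Int.cast_mul]
  rw [← coeff_Pg_comp g _ τ, ← mul_assoc, mul_comm ((Equiv.Perm.sign τ : ℤ) : K)]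
  congr 1
  have : (∀ i, dl N (σ i) ≤ e i) ↔ (∀ i, dl N (σ (τ i)) ≤ e (τ i)) :=
    (τ.forall_congr_right (q := fun i => dl N (σ i) ≤ e i)).symm
  simp only [this]
  rfl

theorem Lf_deg {K : Type*} [CommRing K] {N n : ℕ} (g : Equiv.Perm (Fin n)) (e : Fin N → ℕ)
    (h : Lf e (Pg (MvPolynomial.X : Fin N → MvPolynomial (Fin N) K) g) ≠ 0) :
    ∑ i, e i = n + ∑ i, dl N i := by
  rw [Lf_eq] at h
  obtain ⟨σ, _, hσ⟩ := Finset.exists_ne_zero_of_sum_ne_zero h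
  by_cases h1 : ∀ i, dl N (σ i) ≤ e i
  · rw [if_pos h1] at hσ
    have h2 := coeff_Pg_sum g _ (right_ne_zero_of_mul hσ)
    have h3 : ∑ i, dl N (σ i) = ∑ i, dl N i := Equiv.sum_comp σ (dl N)
    have h4 : ∑ i, (e i - dl N (σ i)) + ∑ i, dl N (σ i) = ∑ i, e i := by
      rw [← Finset.sum_add_distrib]
      exact Finset.sum_congr rfl fun i _ => Nat.sub_add_cancel (h1 i)
    omega
  · simp [if_neg h1] at hσ

theorem coeff_alt {K : Type*} [CommRing K] {N : ℕ} (e α : Fin N → ℕ) :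
    MvPolynomial.coeff (fs e) (alt (MvPolynomial.X : Fin N → MvPolynomial (Fin N) K) α) =
    ∑ σ : Equiv.Perm (Fin N), ((Equiv.Perm.sign σ : ℤ) : K) * if α ∘ σ = e then 1 else 0 := by
  rw [alt_apply, MvPolynomial.coeff_sum]
  refine Finset.sum_congr rfl fun σ _ => ?_
  have : (((Equiv.Perm.sign σ : ℤ) : MvPolynomial (Fin N) K)) = MvPolynomial.C ((Equiv.Perm.sign σ : ℤ) : K) := by simp
  rw [prod_X_pow (fun i => α (σ i)), this, MvPolynomial.coeff_C_mul, MvPolynomial.coeff_monomial]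
  congr 1
  have h : fs (fun i => α (σ i)) = fs e ↔ α ∘ σ = e := fs_inj
  simp only [h]

theorem strictAnti_ge {N : ℕ} {a : Fin N → ℕ} (ha : StrictAnti a) (i j : Fin N) (h : i ≤ j) :
    a j + (j - i) ≤ a i := by
  obtain ⟨k, hk⟩ : ∃ k, (j : ℕ) = i + k := ⟨j - i, by have : (i : ℕ) ≤ j := h; omega⟩
  induction k generalizing j with
  | zero =>
    have : i = j := Fin.ext (by omega)
    subst this; simp
  | succ k ih =>
    have hj := j.2
    have h1 := ih ⟨j - 1, by omega⟩ (by rw [Fin.le_def]; simp; omega) (by simp; omega)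
    have h2 : a j < a ⟨j - 1, by omega⟩ := ha (by rw [Fin.lt_def]; simp; omega)
    simp at h1
    omega

theorem exists_part {N n : ℕ} (e : Fin N → ℕ) (he : Function.Injective e)
    (hs : ∑ i, e i = n + ∑ i, dl N i) :
    ∃ l : Partition', size l = n ∧ ∃ σ : Equiv.Perm (Fin N), pe N l ∘ σ = e := by
  let τ : Equiv.Perm (Fin N) := Fin.revPerm.trans (Tuple.sort e)
  have ha : StrictAnti (e ∘ τ) := by
    have h1 : StrictMono (e ∘ Tuple.sort e) :=
      (Tuple.monotone_sort e).strictMono_of_injective (he.comp (Equiv.injective _))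
    intro i j hij
    exact h1 (Fin.rev_lt_rev.2 hij)
  have hdl : ∀ i, dl N i ≤ (e ∘ τ) i := by
    intro i
    have hi := i.2
    have := strictAnti_ge ha i ⟨N - 1, by omega⟩ (by rw [Fin.le_def]; simp; omega)
    simp [dl] at this ⊢
    omega
  have hanti : ∀ i j : Fin N, i ≤ j → (e ∘ τ) j - dl N j ≤ (e ∘ τ) i - dl N i := by
    intro i j h
    have := strictAnti_ge ha i j h
    have h1 := hdl j
    have h2 := j.2
    have h3 : (i : ℕ) ≤ j := h
    simp only [dl] at *
    omega
  let l : Partition' := ⟨Finsupp.onFinset (Finset.range N)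
    (fun i => if h : i < N then (e ∘ τ) ⟨i, h⟩ - dl N ⟨i, h⟩ else 0) (by
      intro i hi
      by_contra h
      simp only [Finset.mem_range] at h
      simp [h] at hi), by
    intro i j hij
    simp only [Finsupp.onFinset_apply]
    by_cases hj : j < N
    · rw [dif_pos hj, dif_pos (by omega : i < N)]
      exact hanti _ _ hij
    · rw [dif_neg hj]; omega⟩
  have hl : ∀ i : Fin N, l.1 i = (e ∘ τ) i - dl N i := by
    intro i
    simp [l]
  have hpe : pe N l = e ∘ τ := by
    ext i
    rw [pe, hl]
    exact Nat.sub_add_cancel (hdl i)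
  refine ⟨l, ?_, τ⁻¹, ?_⟩
  · rw [← size_eq_sum l N]
    · have h1 : ∑ i, pe N l i = ∑ i, e i := by rw [hpe]; exact Equiv.sum_comp τ e
      simp only [pe] at h1
      rw [Finset.sum_add_distrib, hs] at h1
      omega
    · intro i hi
      simp [l]
      intro h; omega
  · rw [hpe]
    ext i; simp

theorem frob {N n : ℕ} (hN : n ≤ N) (g : Equiv.Perm (Fin n)) :
    Pg (MvPolynomial.X : Fin N → MvPolynomial (Fin N) ℚ) g =
    ∑ l ∈ Par n, MvPolynomial.C (Lf (pe N l) (Pg (MvPolynomial.X : Fin N → MvPolynomial (Fin N) ℚ) g)) *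
      sch MvPolynomial.X (pe N l) := by
  have hne : alt (MvPolynomial.X : Fin N → MvPolynomial (Fin N) ℚ) (dl N) ≠ 0 := by
    intro h
    have h1 := coeff_alt (K := ℚ) (dl N) (dl N)
    rw [h] at h1
    have h0 : StrictAnti (dl N) := by
      intro i j hij
      have h2 := i.2
      have h3 := j.2
      have : (i : ℕ) < j := hij
      simp only [dl]
      omega
    rw [Finset.sum_eq_single 1] at h1
    · simp at h1
    · intro σ _ hσ
      rw [if_neg, mul_zero]
      intro hc
      exact hσ (strictAnti_perm h0 h0 σ hc.symm)
    · simp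
  apply mul_left_cancel₀ hne
  rw [Finset.mul_sum]
  have h1 : ∀ l, alt (MvPolynomial.X : Fin N → MvPolynomial (Fin N) ℚ) (dl N) *
      (MvPolynomial.C (Lf (pe N l) (Pg (MvPolynomial.X : Fin N → MvPolynomial (Fin N) ℚ) g)) *
      sch MvPolynomial.X (pe N l)) =
      MvPolynomial.C (Lf (pe N l) (Pg (MvPolynomial.X : Fin N → MvPolynomial (Fin N) ℚ) g)) *
      alt MvPolynomial.X (pe N l) := fun l => by
    rw [alt_eq _ (pe N l)]; ring
  simp only [h1]
  ext e
  obtain ⟨e, rfl⟩ : ∃ e', e = fs e' := ⟨e, (fs_coe e).symm⟩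
  rw [← Lf_apply, MvPolynomial.coeff_sum]
  simp only [MvPolynomial.coeff_C_mul, coeff_alt, Finset.mul_sum]
  by_cases he : Function.Injective e ∧ ∑ i, e i = n + ∑ i, dl N i
  · obtain ⟨l, hl, σ, hσ⟩ := exists_part e he.1 he.2
    have hu : ∀ m ∈ Par n, ∀ τ : Equiv.Perm (Fin N), pe N m ∘ τ = e → m = l ∧ τ = σ := by
      intro m hm τ hτ
      rw [mem_Par] at hm
      have h2 : pe N m = pe N l ∘ (σ * τ⁻¹ : Equiv.Perm (Fin N)) := by
        rw [Equiv.Perm.coe_mul, ← Function.comp_assoc, hσ, ← hτ]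
        ext i; simp
      have h3 := strictAnti_perm (pe_strictAnti m N) (pe_strictAnti l N) _ h2
      rw [h3] at h2
      exact ⟨pe_inj (by omega) (by omega) h2, (mul_inv_eq_one.1 h3).symm⟩
    rw [Finset.sum_eq_single l, Finset.sum_eq_single σ]
    · rw [if_pos hσ, mul_one, mul_comm, ← Lf_comp, hσ]
    · intro τ _ hτ
      rw [if_neg, mul_zero, mul_zero]
      intro hc
      exact hτ (hu l (mem_Par.2 hl) τ hc).2
    · simp
    · intro m hm hml
      apply Finset.sum_eq_zero
      intro τ _
      rw [if_neg, mul_zero, mul_zero]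
      intro hc
      exact hml (hu m hm τ hc).1
    · intro h; exact absurd (mem_Par.2 hl) h
  · have hz : Lf e (Pg (MvPolynomial.X : Fin N → MvPolynomial (Fin N) ℚ) g) = 0 := by
      by_contra hc
      apply he
      refine ⟨?_, Lf_deg g e hc⟩
      intro i j hij
      by_contra hne
      have h2 := Lf_comp (K := ℚ) g e (Equiv.swap i j)
      have h3 : e ∘ Equiv.swap i j = e := by
        ext k
        simp only [Function.comp_apply, Equiv.swap_apply_def]
        split_ifs with h4 h5
        · rw [h4, hij]
        · rw [h5, hij]
        · rfl
      rw [h3, Equiv.Perm.sign_swap hne] at h2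
      simp at h2
      exact hc (by linarith)
    rw [hz]
    symm
    apply Finset.sum_eq_zero
    intro l hl
    apply Finset.sum_eq_zero
    intro σ _
    rw [if_neg, mul_zero, mul_zero]
    intro hc
    apply he
    rw [mem_Par] at hl
    constructor
    · rw [← hc]
      exact (pe_strictAnti l N).injective.comp σ.injective
    · rw [← hc, ← hl, ← sum_pe l (by omega)]
      exact Equiv.sum_comp σ (pe N l)

/-- orthonormality -/
theorem ortho {N n : ℕ} (hN : n ≤ N) (l m : Partition') (hl : size l = n) (hm : size m = n) :
    ∑ g : Equiv.Perm (Fin n), Lf (pe N l) (Pg (MvPolynomial.X : Fin N → MvPolynomial (Fin N) ℚ) g) *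
      Lf (pe N m) (Pg (MvPolynomial.X : Fin N → MvPolynomial (Fin N) ℚ) g) =
      if l = m then (n.factorial : ℚ) else 0 := by
  have h1 := sum_Lf_Pg (K := MvPolynomial (Fin N) ℚ) (n := n)
    (MvPolynomial.X : Fin N → MvPolynomial (Fin N) ℚ) (pe N l) (by rw [sum_pe l (by omega), hl])
  have h2 := congrArg (Lf (pe N m)) h1
  rw [map_sum, ← nsmul_eq_mul, map_nsmul, Lf_apply, ← alt_eq, coeff_alt] at h2
  have h3 : ∀ g : Equiv.Perm (Fin n), Lf (pe N l) (Pg (MvPolynomial.X : Fin N → MvPolynomial (Fin N) (MvPolynomial (Fin N) ℚ)) g)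
    = MvPolynomial.C (Lf (pe N l) (Pg (MvPolynomial.X : Fin N → MvPolynomial (Fin N) ℚ) g)) := by
    intro g
    rw [Lf_map, Pg_map]
    simp
  simp only [h3, ← MvPolynomial.smul_eq_C_mul, map_smul, smul_eq_mul] at h2
  rw [h2]
  split_ifs with h
  · subst h
    rw [Finset.sum_eq_single 1]
    · simp
    · intro σ _ hσ
      rw [if_neg, mul_zero]
      intro hc
      exact hσ (strictAnti_perm (pe_strictAnti l N) (pe_strictAnti l N) σ hc.symm)
    · simp
  · rw [Finset.sum_eq_zero, smul_zero]
    intro σ _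
    rw [if_neg, mul_zero]
    intro hc
    have h4 := strictAnti_perm (pe_strictAnti m N) (pe_strictAnti l N) σ hc.symm
    rw [h4] at hc
    exact h (pe_inj (by omega) (by omega) hc)

end AgS

open scoped BigOperators
open scoped Classical

namespace AgS
open Partition'

theorem sch_step {S R : Type*} [Fintype S] [CommRing R] (w : S → R) (l : Partition') (N : ℕ)
    (h : l.1 N = 0) : sch w (pe (N + 1) l) = sch w (pe N l) := by
  rw [sch, Matrix.det_succ_row _ (Fin.last N), Fin.sum_univ_castSucc, Finset.sum_eq_zero, zero_add]
  · have h1 : JTm w (pe (N + 1) l) (Fin.last N) (Fin.last N) = 1 := by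
      simp [JTm, pe, dl, h, hh_zero]
    rw [h1, sch]
    have h2 : (JTm w (pe (N + 1) l)).submatrix (Fin.last N).succAbove (Fin.last N).succAbove = JTm w (pe N l) := by
      ext i j
      have hi := i.2
      have hj := j.2
      simp only [Matrix.submatrix_apply, Fin.succAbove_last, JTm, Matrix.of_apply, pe, dl, Fin.val_castSucc]
      have e1 : (N + 1 - 1 - (j : ℕ) ≤ l.1 i + (N + 1 - 1 - i)) ↔ (N - 1 - (j : ℕ) ≤ l.1 i + (N - 1 - i)) := by omega
      have e2 : l.1 i + (N + 1 - 1 - i) - (N + 1 - 1 - (j : ℕ)) = l.1 i + (N - 1 - i) - (N - 1 - (j : ℕ)) := by omega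
      rw [e2]
      exact ite_congr (propext e1) (fun _ => rfl) (fun _ => rfl)
    rw [h2]
    simp [← two_mul]
  · intro j _
    have hj := j.2
    have : JTm w (pe (N + 1) l) (Fin.last N) j.castSucc = 0 := by
      simp only [JTm, Matrix.of_apply, pe, dl]
      refine if_neg ?_
      simp [h]
      omega
    rw [this]; simp

theorem sch_stab {S R : Type*} [Fintype S] [CommRing R] (w : S → R) (l : Partition') (N : ℕ)
    (h : size l ≤ N) : sch w (pe N l) = sch w (pe (size l) l) := by
  induction N, h using Nat.le_induction with
  | base => rfl
  | succ N hN ih => rw [sch_step _ _ _ (part_eq_zero l N hN), ih]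

/-- the character with N variables -/
noncomputable def chN (N : ℕ) {n : ℕ} (l : Partition') (g : Equiv.Perm (Fin n)) : ℚ :=
  Lf (pe N l) (Pg (MvPolynomial.X : Fin N → MvPolynomial (Fin N) ℚ) g)

theorem chN_map {A : Type*} [CommRing A] [Algebra ℚ A] (N : ℕ) {n : ℕ} (l : Partition') (g : Equiv.Perm (Fin n)) :
    algebraMap ℚ A (chN N l g) = Lf (pe N l) (Pg (MvPolynomial.X : Fin N → MvPolynomial (Fin N) A) g) := by
  rw [chN, Lf_map, Pg_map]
  simp

theorem sum_chN_Pg {A S : Type*} [CommRing A] [Algebra ℚ A] [Fintype S] {N n : ℕ} (w : S → A) (l : Partition')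
    (hl : size l = n) (hN : n ≤ N) :
    ∑ g : Equiv.Perm (Fin n), algebraMap ℚ A (chN N l g) * Pg w g = (n.factorial : A) * sch w (pe N l) := by
  simp only [chN_map]
  exact sum_Lf_Pg _ _ (by rw [sum_pe l (by omega), hl])

theorem chN_stab (N : ℕ) {n : ℕ} (l : Partition') (g : Equiv.Perm (Fin n)) (hl : size l = n) (hN : n ≤ N) :
    chN N l g = chN n l g := by
  have h1 : ∀ M, n ≤ M → ∑ g : Equiv.Perm (Fin n), chN M l g * chN n l g = (n.factorial : ℚ) := by
    intro M hM
    have h2 := sum_chN_Pg (MvPolynomial.X : Fin n → MvPolynomial (Fin n) ℚ) l hl hM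
    have h3 := sum_chN_Pg (MvPolynomial.X : Fin n → MvPolynomial (Fin n) ℚ) l hl le_rfl
    rw [sch_stab _ _ _ (by omega : size l ≤ M), hl, ← h3] at h2
    have h4 := congrArg (Lf (pe n l)) h2
    simp only [map_sum, ← Algebra.smul_def, map_smul, smul_eq_mul] at h4
    have h5 := ortho (le_refl n) l l hl hl
    rw [if_pos rfl] at h5
    exact h4.trans h5
  have h2 := h1 N hN
  have h3 := h1 n le_rfl
  have h4 := ortho hN l l hl hl
  rw [if_pos rfl] at h4
  have h5 : ∑ g : Equiv.Perm (Fin n), (chN N l g - chN n l g) ^ 2 = 0 := by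
    have : ∀ g : Equiv.Perm (Fin n), (chN N l g - chN n l g) ^ 2 =
      chN N l g * chN N l g - 2 * (chN N l g * chN n l g) + chN n l g * chN n l g := fun g => by ring
    simp only [this, Finset.sum_add_distrib, Finset.sum_sub_distrib, ← Finset.mul_sum]
    rw [h2, h3]
    unfold chN
    rw [h4]; ring
  rw [Finset.sum_eq_zero_iff_of_nonneg (fun _ _ => sq_nonneg _)] at h5
  have := h5 g (Finset.mem_univ _)
  exact sub_eq_zero.1 (pow_eq_zero_iff (two_ne_zero) |>.1 this)

theorem irrChar_eq {n : ℕ} (l : Partition') (g : Equiv.Perm (Fin n)) :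
    (irrChar n l g : ℚ) = chN n l g := by
  rw [chN, Lf_eq, irrChar, Int.cast_sum]
  refine Finset.sum_congr rfl fun σ _ => ?_
  rw [Int.cast_mul]
  congr 1
  rw [youngCount]
  have hi : ∀ i : Fin n, (0 ≤ (l.1 i : ℤ) + ((σ i : ℕ) : ℤ) - (i : ℤ)) ↔ dl n (σ i) ≤ pe n l i := by
    intro i
    have h1 := i.2
    have h2 := (σ i).2
    simp only [dl, pe]
    omega
  by_cases h : ∀ i, dl n (σ i) ≤ pe n l i
  · rw [if_pos h, if_pos fun i => (hi i).2 (h i), coeff_Pg]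
    have h3 : ∀ i : Fin n, ((l.1 i : ℤ) + ((σ i : ℕ) : ℤ) - (i : ℤ)).toNat = pe n l i - dl n (σ i) := by
      intro i
      have h1 := i.2
      have h2 := (σ i).2
      have h4 := h i
      simp only [dl, pe] at *
      omega
    simp only [h3]
    simp
  · rw [if_neg h, if_neg fun h' => h fun i => (hi i).1 (h' i)]
    simp

theorem irrChar_eq' (N : ℕ) {n : ℕ} (l : Partition') (g : Equiv.Perm (Fin n)) (hl : size l = n) (hN : n ≤ N) :
    (irrChar n l g : ℚ) = chN N l g := by
  rw [irrChar_eq, chN_stab N l g hl hN]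

end AgS

open scoped BigOperators
open scoped Classical

namespace AgS
open Partition'

/-- a bundled finite dimensional rational representation -/
structure RepD (G : Type) [Group G] where
  V : Type
  [i1 : AddCommGroup V]
  [i2 : Module ℚ V]
  [i3 : FiniteDimensional ℚ V]
  ρ : Representation ℚ G V

attribute [instance] RepD.i1 RepD.i2 RepD.i3

noncomputable def RepD.chr {G : Type} [Group G] (A : RepD G) (g : G) : ℚ := A.ρ.character g

theorem tr_exact {W V Q : Type} [AddCommGroup W] [Module ℚ W] [FiniteDimensional ℚ W]
    [AddCommGroup V] [Module ℚ V] [FiniteDimensional ℚ V]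
    [AddCommGroup Q] [Module ℚ Q] [FiniteDimensional ℚ Q]
    (i : W →ₗ[ℚ] V) (π : V →ₗ[ℚ] Q) (hi : Function.Injective i) (hπ : Function.Surjective π)
    (he : Function.Exact i π) (tW : W →ₗ[ℚ] W) (tV : V →ₗ[ℚ] V) (tQ : Q →ₗ[ℚ] Q)
    (h1 : tV ∘ₗ i = i ∘ₗ tW) (h2 : π ∘ₗ tV = tQ ∘ₗ π) :
    LinearMap.trace ℚ V tV = LinearMap.trace ℚ W tW + LinearMap.trace ℚ Q tQ := by
  obtain ⟨s, hs⟩ := π.exists_rightInverse_of_surjective (LinearMap.range_eq_top.2 hπ)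
  obtain ⟨p, hp⟩ := i.exists_leftInverse_of_injective (LinearMap.ker_eq_bot.2 hi)
  have hs' : ∀ q, π (s q) = q := fun q => LinearMap.congr_fun hs q
  have hp' : ∀ q, p (i q) = q := fun q => LinearMap.congr_fun hp q
  have he' : ∀ w, π (i w) = 0 := fun w => he.apply_apply_eq_zero w
  let p' : V →ₗ[ℚ] W := p ∘ₗ (LinearMap.id - s ∘ₗ π)
  have e1 : ∀ v, i (p' v) + s (π v) = v := by
    intro v
    have : π (v - s (π v)) = 0 := by simp [hs']
    obtain ⟨w, hw⟩ := (he _).1 this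
    have : p' v = w := by
      simp only [p', LinearMap.comp_apply, LinearMap.sub_apply, LinearMap.id_apply]
      rw [← hw, hp']
    rw [this, hw]; simp
  have e2 : p' ∘ₗ i = LinearMap.id := by
    ext w; simp [p', he', hp']
  have e3 : tV = (i ∘ₗ (tW ∘ₗ p')) + ((tV ∘ₗ s) ∘ₗ π) := by
    ext v
    have h3 := LinearMap.congr_fun h1 (p' v)
    simp only [LinearMap.comp_apply] at h3
    simp only [LinearMap.add_apply, LinearMap.comp_apply]
    rw [← h3, ← map_add, e1]
  rw [e3, map_add, LinearMap.trace_comp_comm', LinearMap.trace_comp_comm' _ (tV ∘ₗ s)]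
  congr 2
  · rw [LinearMap.comp_assoc, e2]; rfl
  · rw [← LinearMap.comp_assoc, h2, LinearMap.comp_assoc, hs]; rfl

theorem reduce_step {G : Type} [Group G] (A B : RepD G) (f : Representation.IntertwiningMap A.ρ B.ρ)
    (hf : f ≠ 0) : ∃ A' B' : RepD G, (∀ g, A.chr g - B.chr g = A'.chr g - B'.chr g) ∧
      Module.finrank ℚ A'.V < Module.finrank ℚ A.V := by
  have hintw : ∀ g v, f.toLinearMap (A.ρ g v) = B.ρ g (f.toLinearMap v) := fun g v =>
    LinearMap.congr_fun (f.isIntertwining' g) v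
  set F := f.toLinearMap with hF
  have hk : ∀ g, LinearMap.ker F ≤ (LinearMap.ker F).comap (A.ρ g) := by
    intro g v hv
    rw [LinearMap.mem_ker] at hv
    rw [Submodule.mem_comap, LinearMap.mem_ker, hintw, hv, map_zero]
  have hr : ∀ g, LinearMap.range F ≤ (LinearMap.range F).comap (B.ρ g) := by
    rintro g _ ⟨v, rfl⟩
    exact ⟨A.ρ g v, hintw g v⟩
  refine ⟨⟨LinearMap.ker F, A.ρ.subrepresentation _ hk⟩, ⟨B.V ⧸ LinearMap.range F, B.ρ.quotient _ hr⟩, ?_, ?_⟩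
  · intro g
    have h1 := tr_exact (LinearMap.ker F).subtype F.rangeRestrict (Submodule.injective_subtype _)
      F.surjective_rangeRestrict (by
        intro v
        constructor
        · intro h
          refine ⟨⟨v, ?_⟩, rfl⟩
          rw [LinearMap.mem_ker]
          exact congrArg Subtype.val h
        · rintro ⟨w, rfl⟩
          apply Subtype.ext
          exact w.2) (A.ρ.subrepresentation _ hk g) (A.ρ g) (B.ρ.subrepresentation _ hr g)
        (by ext v; rfl) (by
          ext v
          exact hintw g v)
    have h2 := tr_exact (LinearMap.range F).subtype (LinearMap.range F).mkQ (Submodule.injective_subtype _)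
      (Submodule.mkQ_surjective _) (by
        intro v
        simp) (B.ρ.subrepresentation _ hr g) (B.ρ g) (B.ρ.quotient _ hr g)
        (by ext v; rfl) (by ext v; rfl)
    simp only [RepD.chr, Representation.character]
    rw [h1, h2]; ring
  · apply Submodule.finrank_lt
    intro h
    rw [LinearMap.ker_eq_top] at h
    apply hf
    apply Representation.IntertwiningMap.ext
    exact h

theorem reduce {G : Type} [Group G] (d : ℕ) : ∀ A B : RepD G, Module.finrank ℚ A.V = d →
    ∃ A' B' : RepD G, (∀ g, A.chr g - B.chr g = A'.chr g - B'.chr g) ∧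
      ∀ f : Representation.IntertwiningMap A'.ρ B'.ρ, f = 0 := by
  induction d using Nat.strong_induction_on with
  | _ d ih =>
    intro A B hA
    by_cases h : ∀ f : Representation.IntertwiningMap A.ρ B.ρ, f = 0
    · exact ⟨A, B, fun _ => rfl, h⟩
    · push Not at h
      obtain ⟨f, hf⟩ := h
      obtain ⟨A1, B1, h1, h2⟩ := reduce_step A B f hf
      obtain ⟨A2, B2, h3, h4⟩ := ih _ (hA ▸ h2) A1 B1 rfl
      exact ⟨A2, B2, fun g => (h1 g).trans (h3 g), h4⟩

theorem inner_nat {G : Type} [Group G] [Fintype G] (A B : RepD G) :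
    ∑ g : G, B.chr g * A.chr g⁻¹ = Fintype.card G * Module.finrank ℚ (Representation.IntertwiningMap A.ρ B.ρ) := by
  have hne : (Nat.card G : ℚ) ≠ 0 := by
    rw [Nat.card_eq_fintype_card]
    exact_mod_cast Fintype.card_ne_zero
  let _ : Invertible (Nat.card G : ℚ) := invertibleOfNonzero hne
  have := Representation.card_inv_mul_sum_char_mul_char_eq_finrank A.ρ B.ρ
  rw [inv_mul_eq_iff_eq_mul₀ hne, Nat.card_eq_fintype_card] at this
  exact this

theorem inv_nat {G : Type} [Group G] [Fintype G] (A : RepD G) :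
    ∃ k : ℕ, ∑ g : G, A.chr g = Fintype.card G * k := by
  have hne : (Nat.card G : ℚ) ≠ 0 := by
    rw [Nat.card_eq_fintype_card]
    exact_mod_cast Fintype.card_ne_zero
  let _ : Invertible (Nat.card G : ℚ) := invertibleOfNonzero hne
  have := Representation.card_inv_mul_sum_char_eq_finrank A.ρ
  rw [inv_mul_eq_iff_eq_mul₀ hne, Nat.card_eq_fintype_card] at this
  exact ⟨_, this⟩

theorem chr_zero_of {G : Type} [Group G] (A : RepD G)
    (h : Module.finrank ℚ (Representation.IntertwiningMap A.ρ A.ρ) = 0) (g : G) : A.chr g = 0 := by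
  have h1 : Subsingleton (Representation.IntertwiningMap A.ρ A.ρ) := Module.finrank_zero_iff.1 h
  have h2 := Subsingleton.elim (Representation.IntertwiningMap.id A.ρ) 0
  have h3 : ∀ v : A.V, v = 0 := fun v => by
    have := congrArg (fun f : Representation.IntertwiningMap A.ρ A.ρ => f.toLinearMap v) h2
    exact this
  have h4 : A.ρ g = 0 := by ext v; exact h3 _
  simp [RepD.chr, Representation.character, h4]

theorem irr_of_norm {G : Type} [Group G] [Fintype G] (A B : RepD G) (χ : G → ℚ)
    (hχ : ∀ g, χ g = A.chr g - B.chr g) (hinv : ∀ g, χ g⁻¹ = χ g) (hn : ∑ g, χ g * χ g = Fintype.card G) :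
    ∃ C : RepD G, (∀ g, χ g = C.chr g) ∨ ∀ g, χ g = - C.chr g := by
  obtain ⟨A, B, h1, h2⟩ := reduce _ A B rfl
  replace hχ : ∀ g, χ g = A.chr g - B.chr g := fun g => (hχ g).trans (h1 g)
  have hAB : ∑ g : G, B.chr g * A.chr g⁻¹ = 0 := by
    rw [inner_nat]
    have : Subsingleton (Representation.IntertwiningMap A.ρ B.ρ) := ⟨fun f f' => by rw [h2 f, h2 f']⟩
    rw [Module.finrank_zero_of_subsingleton]; simp
  have hBA : ∑ g : G, A.chr g * B.chr g⁻¹ = 0 := by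
    rw [← hAB]
    refine Fintype.sum_equiv (Equiv.inv G) _ _ fun g => ?_
    simp [mul_comm]
  have h3 : ∑ g, χ g * χ g = ∑ g, (A.chr g * A.chr g⁻¹ + B.chr g * B.chr g⁻¹ -
      B.chr g * A.chr g⁻¹ - A.chr g * B.chr g⁻¹) := by
    refine Finset.sum_congr rfl fun g _ => ?_
    nth_rw 2 [← hinv g]
    rw [hχ, hχ]; ring
  rw [Finset.sum_sub_distrib, Finset.sum_sub_distrib, Finset.sum_add_distrib, hAB, hBA, hn, inner_nat, inner_nat,
    ← mul_add, sub_zero, sub_zero] at h3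
  have hne : (Fintype.card G : ℚ) ≠ 0 := by exact_mod_cast Fintype.card_ne_zero
  have h4 : Module.finrank ℚ (Representation.IntertwiningMap A.ρ A.ρ) +
      Module.finrank ℚ (Representation.IntertwiningMap B.ρ B.ρ) = 1 := by
    have := mul_left_cancel₀ hne ((mul_one _).trans h3)
    exact_mod_cast this.symm
  by_cases hA : Module.finrank ℚ (Representation.IntertwiningMap A.ρ A.ρ) = 0
  · refine ⟨B, Or.inr fun g => ?_⟩
    rw [hχ, chr_zero_of A hA]; ring
  · refine ⟨A, Or.inl fun g => ?_⟩
    rw [hχ, chr_zero_of B (by omega)]; ring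

/-- differences of characters -/
def IsVirt {G : Type} [Group G] (χ : G → ℚ) : Prop := ∃ A B : RepD G, ∀ g, χ g = A.chr g - B.chr g

noncomputable def RepD.zero (G : Type) [Group G] : RepD G := ⟨Fin 0 → ℚ, 1⟩

theorem RepD.zero_chr (G : Type) [Group G] (g : G) : (RepD.zero G).chr g = 0 := by
  have : Module.finrank ℚ (Fin 0 → ℚ) = 0 := by simp
  have h2 : LinearMap.trace ℚ (Fin 0 → ℚ) 1 = 0 := by
    rw [LinearMap.trace_one, this]; simp
  exact h2

noncomputable def RepD.add {G : Type} [Group G] (A B : RepD G) : RepD G := ⟨A.V × B.V, A.ρ.prod B.ρ⟩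

theorem RepD.add_chr {G : Type} [Group G] (A B : RepD G) (g : G) :
    (A.add B).chr g = A.chr g + B.chr g := LinearMap.trace_prodMap' _ _

noncomputable def RepD.tensor {G : Type} [Group G] (A B : RepD G) : RepD G := ⟨TensorProduct ℚ A.V B.V, A.ρ.tprod B.ρ⟩

theorem RepD.tensor_chr {G : Type} [Group G] (A B : RepD G) (g : G) :
    (A.tensor B).chr g = A.chr g * B.chr g := LinearMap.trace_tensorProduct' _ _

noncomputable def RepD.res {G H : Type} [Group G] [Group H] (A : RepD G) (φ : H →* G) : RepD H :=
  ⟨A.V, A.ρ.comp φ⟩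

theorem RepD.res_chr {G H : Type} [Group G] [Group H] (A : RepD G) (φ : H →* G) (h : H) :
  (A.res φ).chr h = A.chr (φ h) := rfl

noncomputable def RepD.perm {G Y : Type} [Group G] [Fintype Y] (act : G → Y → Y) (h1 : ∀ y, act 1 y = y)
    (h2 : ∀ g h y, act (g * h) y = act h (act g y)) : RepD G :=
  ⟨Y → ℚ, { toFun := fun g => LinearMap.funLeft ℚ ℚ (act g)
            map_one' := by
              ext f y
              simp [LinearMap.funLeft_apply, h1]
            map_mul' := by
              intro g h
              ext f y
              simp [LinearMap.funLeft_apply, h2] }⟩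

theorem RepD.perm_chr {G Y : Type} [Group G] [Fintype Y] (act : G → Y → Y) (h1 : ∀ y, act 1 y = y)
    (h2 : ∀ g h y, act (g * h) y = act h (act g y)) (g : G) :
    (RepD.perm act h1 h2).chr g = (Nat.card {y // act g y = y} : ℚ) := by
  change LinearMap.trace ℚ (Y → ℚ) (LinearMap.funLeft ℚ ℚ (act g)) = _
  rw [LinearMap.trace_eq_matrix_trace ℚ (Pi.basisFun ℚ Y), Matrix.trace, Nat.card_eq_fintype_card,
    Fintype.card_subtype, Finset.card_eq_sum_ones, Nat.cast_sum, Finset.sum_filter]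
  refine Finset.sum_congr rfl fun y _ => ?_
  simp [LinearMap.toMatrix_apply, LinearMap.funLeft_apply, Pi.single_apply]

theorem IsVirt.add {G : Type} [Group G] {χ ψ : G → ℚ} (h1 : IsVirt χ) (h2 : IsVirt ψ) :
    IsVirt fun g => χ g + ψ g := by
  obtain ⟨A, B, h⟩ := h1
  obtain ⟨C, D, h'⟩ := h2
  refine ⟨A.add C, B.add D, fun g => ?_⟩
  simp only [RepD.add_chr, h, h']; ring

theorem IsVirt.neg {G : Type} [Group G] {χ : G → ℚ} (h1 : IsVirt χ) :
    IsVirt fun g => - χ g := by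
  obtain ⟨A, B, h⟩ := h1
  refine ⟨B, A, fun g => ?_⟩
  simp only [h]; ring

theorem IsVirt.zero {G : Type} [Group G] : IsVirt fun _ : G => 0 :=
  ⟨RepD.zero G, RepD.zero G, fun g => by simp⟩

theorem IsVirt.sum {G ι : Type} [Group G] (s : Finset ι) (χ : ι → G → ℚ) (h : ∀ i, IsVirt (χ i)) :
    IsVirt fun g => ∑ i ∈ s, χ i g := by
  induction s using Finset.induction_on with
  | empty => simpa using IsVirt.zero
  | insert a s ha ih =>
    simp only [Finset.sum_insert ha]
    exact (h a).add ih

theorem youngCount_virt (n : ℕ) (a : Fin n → ℤ) : IsVirt fun g => (youngCount n a g : ℚ) := by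
  unfold youngCount
  split_ifs with h
  · let Y := {f : Fin n → Fin n // ∀ i : Fin n, Nat.card {x : Fin n // f x = i} = (a i).toNat}
    let act : Equiv.Perm (Fin n) → Y → Y := fun g f => ⟨f.1 ∘ g, fun i => by
      rw [← f.2 i]
      exact Nat.card_congr (Equiv.subtypeEquiv g fun x => Iff.rfl)⟩
    have a1 : ∀ y, act 1 y = y := fun y => rfl
    have a2 : ∀ g h y, act (g * h) y = act h (act g y) := fun g h y => rfl
    refine ⟨RepD.perm act a1 a2, RepD.zero _, fun g => ?_⟩
    have e1 := RepD.perm_chr act a1 a2 g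
    rw [e1, RepD.zero_chr, sub_zero]
    simp only [Int.cast_natCast]
    congr 1
    refine Nat.card_congr ⟨fun f => ⟨⟨f.1, f.2.2⟩, Subtype.ext f.2.1⟩,
      fun f => ⟨f.1.1, congrArg Subtype.val f.2, f.1.2⟩, fun _ => rfl, fun _ => rfl⟩
  · simpa using IsVirt.zero

theorem irrChar_virt (n : ℕ) (l : Partition') : IsVirt fun g => (irrChar n l g : ℚ) := by
  unfold irrChar
  simp only [Int.cast_sum, Int.cast_mul]
  apply IsVirt.sum
  intro σ
  rcases Int.units_eq_one_or (Equiv.Perm.sign σ) with h | h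
  · simpa [h] using youngCount_virt n _
  · simpa [h] using (youngCount_virt n _).neg

end AgS

open scoped BigOperators
open scoped Classical

namespace AgS
open Partition'

def stabF {n N : ℕ} (f : Fin n → Fin N) : Subgroup (Equiv.Perm (Fin n)) where
  carrier := {g | f ∘ g = f}
  mul_mem' := by
    intro a b ha hb
    change f ∘ (a ∘ b) = f
    rw [← Function.comp_assoc, show f ∘ a = f from ha]
    exact hb
  one_mem' := rfl
  inv_mem' := by
    intro g h
    have h' : f ∘ g = f := h
    change f ∘ (g⁻¹ : Equiv.Perm (Fin n)) = f
    conv_lhs => rw [← h']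
    ext i; simp

theorem chr_Pg_nonneg {n N : ℕ} (C : RepD (Equiv.Perm (Fin n))) (w : Fin N → ℚ) (hw : ∀ i, 0 ≤ w i) :
    0 ≤ ∑ g, C.chr g * Pg w g := by
  unfold Pg
  simp only [Finset.mul_sum]
  rw [Finset.sum_comm]
  apply Finset.sum_nonneg
  intro f _
  have h1 : ∑ g : Equiv.Perm (Fin n), C.chr g * (if f ∘ g = f then ∏ i, w (f i) else 0) =
      (∏ i, w (f i)) * ∑ g ∈ Finset.univ.filter (fun g : Equiv.Perm (Fin n) => f ∘ g = f), C.chr g := by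
    rw [Finset.sum_filter, Finset.mul_sum]
    refine Finset.sum_congr rfl fun g _ => ?_
    split_ifs
    · ring
    · simp
  obtain ⟨k, hk⟩ := inv_nat (C.res (stabF f).subtype)
  have h2 : ∑ g ∈ Finset.univ.filter (fun g : Equiv.Perm (Fin n) => f ∘ g = f), C.chr g =
      ∑ g : stabF f, (C.res (stabF f).subtype).chr g := by
    rw [Finset.sum_subtype (p := fun g => g ∈ stabF f)]
    · rfl
    · intro g
      simp only [Finset.mem_filter, Finset.mem_univ, true_and]
      rfl
  refine le_of_le_of_eq ?_ ((Finset.sum_congr rfl fun g _ => by congr!).trans h1).symm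
  rw [h2, hk]
  have := Finset.prod_nonneg (s := Finset.univ) fun i (_ : i ∈ Finset.univ) => hw (f i)
  positivity

noncomputable def wv (N : ℕ) (k : Fin N) : ℚ := 2 ^ dl N k

theorem alt_wv {N : ℕ} (α : Fin N → ℕ) :
    alt (wv N) α = ((Equiv.Perm.sign (Fin.revPerm (n := N)) : ℤ) : ℚ) *
      ∏ i : Fin N, ∏ j ∈ Finset.Ioi i, ((2 : ℚ) ^ α j - 2 ^ α i) := by
  rw [← Matrix.det_vandermonde, ← Matrix.det_permute', alt]
  congr 1
  ext i k
  simp only [Matrix.of_apply, Matrix.submatrix_apply, Matrix.vandermonde_apply, wv, id]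
  rw [← pow_mul, ← pow_mul, mul_comm]
  congr 2
  simp [dl, Fin.val_rev]; omega

theorem sch_wv_pos {N : ℕ} (α : Fin N → ℕ) (hα : StrictAnti α) : 0 < sch (wv N) α := by
  have h0 : StrictAnti (dl N) := by
    intro i j hij
    have h2 := i.2
    have h3 := j.2
    have : (i : ℕ) < j := hij
    simp only [dl]
    omega
  have h1 := alt_eq (wv N) α
  rw [alt_wv, alt_wv] at h1
  have hs : ((Equiv.Perm.sign (Fin.revPerm (n := N)) : ℤ) : ℚ) ≠ 0 := by
    exact_mod_cast (Equiv.Perm.sign (Fin.revPerm (n := N))).ne_zero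
  rw [mul_assoc] at h1
  have h2 := mul_left_cancel₀ hs h1
  have key : ∀ β : Fin N → ℕ, StrictAnti β → ∀ i : Fin N, ∀ j ∈ Finset.Ioi i, ((2 : ℚ) ^ β j - 2 ^ β i) < 0 := by
    intro β hβ i j hj
    have := hβ (Finset.mem_Ioi.1 hj)
    rw [sub_neg]
    exact pow_lt_pow_right₀ (by norm_num) this
  have h3 : 0 < (∏ i : Fin N, ∏ j ∈ Finset.Ioi i, ((2 : ℚ) ^ α j - 2 ^ α i)) *
      (∏ i : Fin N, ∏ j ∈ Finset.Ioi i, ((2 : ℚ) ^ dl N j - 2 ^ dl N i)) := by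
    rw [← Finset.prod_mul_distrib]
    apply Finset.prod_pos
    intro i _
    rw [← Finset.prod_mul_distrib]
    apply Finset.prod_pos
    intro j hj
    exact mul_pos_of_neg_of_neg (key _ hα i j hj) (key _ h0 i j hj)
  rw [h2] at h3
  by_contra hc
  push Not at hc
  nlinarith [mul_self_nonneg (∏ i : Fin N, ∏ j ∈ Finset.Ioi i, ((2 : ℚ) ^ dl N j - 2 ^ dl N i))]

theorem chN_inv (N : ℕ) {n : ℕ} (l : Partition') (g : Equiv.Perm (Fin n)) : chN N l g⁻¹ = chN N l g := by
  rw [chN, chN, Pg_inv]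

theorem exists_rep {n : ℕ} (l : Partition') (hl : size l = n) :
    ∃ C : RepD (Equiv.Perm (Fin n)), ∀ g, (irrChar n l g : ℚ) = C.chr g := by
  obtain ⟨A, B, hAB⟩ := irrChar_virt n l
  have ho := ortho (le_refl n) l l hl hl
  rw [if_pos rfl] at ho
  obtain ⟨C, hC⟩ := irr_of_norm A B (fun g => (irrChar n l g : ℚ)) hAB
    (fun g => by simp only [irrChar_eq, chN_inv])
    (by
      simp only [irrChar_eq]
      rw [Fintype.card_perm, Fintype.card_fin]
      exact ho)
  refine ⟨C, ?_⟩
  rcases hC with hC | hC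
  · exact hC
  · exfalso
    have h1 := chr_Pg_nonneg C (wv n) (fun i => by unfold wv; positivity)
    have h2 := sum_chN_Pg (wv n) l hl le_rfl
    have h3 := sch_wv_pos (pe n l) (pe_strictAnti l n)
    have h4 : ∀ g, algebraMap ℚ ℚ (chN n l g) = - C.chr g := fun g => by
      rw [← hC]; simp [irrChar_eq]
    simp only [h4, neg_mul, Finset.sum_neg_distrib] at h2
    have h5 : 0 < (n.factorial : ℚ) * sch (wv n) (pe n l) := mul_pos (by exact_mod_cast n.factorial_pos) h3
    linarith

theorem toNat_div (s f : ℤ) (k : ℕ) (hf : f ≠ 0) (h : s = f * k) : (s / f).toNat = k := by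
  rw [h, Int.mul_ediv_cancel_left _ hf]; simp

theorem kron_eq {n : ℕ} (l m nu : Partition') (hl : size l = n) (hm : size m = n) (hnu : size nu = n) :
    (n.factorial : ℚ) * (kron l m nu : ℚ) =
    ∑ g : Equiv.Perm (Fin n), (irrChar n l g : ℚ) * irrChar n m g * irrChar n nu g := by
  subst hnu
  obtain ⟨A, hA⟩ := exists_rep l hl
  obtain ⟨B, hB⟩ := exists_rep m hm
  obtain ⟨C, hC⟩ := exists_rep nu rfl
  obtain ⟨k, hk⟩ := inv_nat ((A.tensor B).tensor C)
  simp only [RepD.tensor_chr, ← hA, ← hB, ← hC, Fintype.card_perm, Fintype.card_fin] at hk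
  rw [hk, kron, if_pos ⟨hl, hm⟩, toNat_div _ _ k]
  · exact_mod_cast (Nat.factorial_pos _).ne'
  · exact_mod_cast hk

def sumHom (a b : ℕ) : Equiv.Perm (Fin a) × Equiv.Perm (Fin b) →* Equiv.Perm (Fin (a + b)) where
  toFun p := sumEmb p.1 p.2
  map_one' := by
    ext x
    simp only [sumEmb, Equiv.permCongr_apply, Prod.fst_one, Prod.snd_one]
    obtain ⟨y, rfl⟩ := finSumFinEquiv.surjective x
    rcases y with y | y <;> simp [-finSumFinEquiv_apply_left, -finSumFinEquiv_apply_right]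
  map_mul' := by
    intro p q
    ext x
    obtain ⟨y, rfl⟩ := finSumFinEquiv.surjective x
    rcases y with y | y <;> simp [sumEmb, Equiv.permCongr_apply, -finSumFinEquiv_apply_left, -finSumFinEquiv_apply_right]

theorem lr_eq {a b : ℕ} (l m nu : Partition') (hl : size l = a) (hm : size m = b) (hnu : size nu = a + b) :
    (a.factorial : ℚ) * (b.factorial : ℚ) * (lr l m nu : ℚ) =
    ∑ g : Equiv.Perm (Fin a), ∑ h : Equiv.Perm (Fin b),
      (irrChar a l g : ℚ) * irrChar b m h * irrChar (a + b) nu (sumEmb g h) := by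
  subst hl hm
  obtain ⟨A, hA⟩ := exists_rep l rfl
  obtain ⟨B, hB⟩ := exists_rep m rfl
  obtain ⟨C, hC⟩ := exists_rep nu hnu
  obtain ⟨k, hk⟩ := inv_nat (((A.res (MonoidHom.fst _ _)).tensor (B.res (MonoidHom.snd _ _))).tensor
    (C.res (sumHom (size l) (size m))))
  simp only [RepD.tensor_chr, RepD.res_chr, ← hA, ← hB, ← hC, Fintype.card_perm, Fintype.card_fin,
    Fintype.card_prod, Fintype.sum_prod_type, MonoidHom.coe_fst, MonoidHom.coe_snd] at hk
  have hk' : ∑ g : Equiv.Perm (Fin (size l)), ∑ h : Equiv.Perm (Fin (size m)),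
      (irrChar (size l) l g : ℚ) * irrChar (size m) m h * irrChar (size l + size m) nu (sumEmb g h) =
      ((size l).factorial * (size m).factorial : ℕ) * (k : ℚ) := hk
  rw [hk', lr, if_pos hnu, toNat_div _ _ k]
  · push_cast; ring
  · have h1 := (Nat.factorial_pos (size l)).ne'
    have h2 := (Nat.factorial_pos (size m)).ne'
    exact_mod_cast mul_ne_zero h1 h2
  · exact_mod_cast hk'

end AgS

open scoped BigOperators
open scoped Classical
open scoped TensorProduct

namespace AgS
open Partition'

abbrev PN (N : ℕ) := MvPolynomial (Fin N) ℚ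

/-- reproducing property with respect to the irreducible characters -/
def Repro (N : ℕ) {n : ℕ} (F : Equiv.Perm (Fin n) → ℚ) : Prop :=
  ∀ g, ∑ α ∈ Par n, chN N α g * ∑ g', chN N α g' * F g' = (n.factorial : ℚ) * F g

theorem Pg_expand {A : Type*} [CommRing A] [Algebra ℚ A] {M n : ℕ} (hM : n ≤ M) (w : Fin M → A)
    (g : Equiv.Perm (Fin n)) :
    Pg w g = ∑ α ∈ Par n, algebraMap ℚ A (chN M α g) * sch w (pe M α) := by
  have h := congrArg (MvPolynomial.aeval w).toRingHom (frob hM g)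
  rw [Pg_map, map_sum] at h
  simp only [map_mul, sch_map] at h
  simp at h
  exact h

theorem repro_of {A S : Type*} [CommRing A] [Algebra ℚ A] [Fintype S] {N n : ℕ} (hN : n ≤ N) (hS : n ≤ Fintype.card S)
    (w : S → A) (φ : A →ₗ[ℚ] ℚ) : Repro N (fun g : Equiv.Perm (Fin n) => φ (Pg w g)) := by
  let e := (Fintype.equivFin S).symm
  let w' : Fin (Fintype.card S) → A := fun i => w (e i)
  have hw : ∀ g : Equiv.Perm (Fin n), Pg w g = Pg w' g := fun g => (Pg_comp w e g).symm
  have hst : ∀ α ∈ Par n, ∀ g : Equiv.Perm (Fin n), chN N α g = chN (Fintype.card S) α g := fun α hα g => by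
    rw [chN_stab N α g (mem_Par.1 hα) hN, chN_stab _ α g (mem_Par.1 hα) hS]
  intro g
  simp only [hw]
  rw [Pg_expand hS w' g, map_sum, Finset.mul_sum]
  refine Finset.sum_congr rfl fun α hα => ?_
  have h1 := congrArg φ (sum_chN_Pg w' α (mem_Par.1 hα) hS)
  rw [map_sum] at h1
  simp only [← Algebra.smul_def, map_smul, smul_eq_mul, ← hst α hα] at h1 ⊢
  rw [h1, ← nsmul_eq_mul, map_nsmul, nsmul_eq_mul]
  ring

theorem repro_mul {N n : ℕ} (hN : n ≤ N) (l m : Partition') :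
    Repro N (fun g : Equiv.Perm (Fin n) => chN N l g * chN N m g) := by
  let x : Fin N → PN N ⊗[ℚ] PN N := fun i => (MvPolynomial.X i) ⊗ₜ 1
  let y : Fin N → PN N ⊗[ℚ] PN N := fun i => 1 ⊗ₜ (MvPolynomial.X i)
  let φ : PN N ⊗[ℚ] PN N →ₗ[ℚ] ℚ := LinearMap.mul' ℚ ℚ ∘ₗ TensorProduct.map (Lf (pe N l)) (Lf (pe N m))
  have h := repro_of (n := n) hN (by rw [Fintype.card_prod, Fintype.card_fin]; nlinarith)
    (fun p : Fin N × Fin N => x p.1 * y p.2) φ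
  have hx : ∀ g : Equiv.Perm (Fin n), Pg x g = (Pg MvPolynomial.X g : PN N) ⊗ₜ[ℚ] (1 : PN N) := fun g =>
    (Pg_map (Algebra.TensorProduct.includeLeft : PN N →ₐ[ℚ] PN N ⊗[ℚ] PN N).toRingHom MvPolynomial.X g).symm
  have hy : ∀ g : Equiv.Perm (Fin n), Pg y g = (1 : PN N) ⊗ₜ[ℚ] (Pg MvPolynomial.X g : PN N) := fun g =>
    (Pg_map (Algebra.TensorProduct.includeRight : PN N →ₐ[ℚ] PN N ⊗[ℚ] PN N).toRingHom MvPolynomial.X g).symm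
  have h2 : ∀ g : Equiv.Perm (Fin n), φ (Pg (fun p : Fin N × Fin N => x p.1 * y p.2) g) = chN N l g * chN N m g := by
    intro g
    rw [← Pg_mul, hx, hy]
    simp [φ, chN]
  simpa only [h2] using h

theorem chN_sumEmb {N a b : ℕ} (l : Partition') (g : Equiv.Perm (Fin a)) (h : Equiv.Perm (Fin b)) :
    chN N l (sumEmb g h) = Lf (pe N l) (Pg MvPolynomial.X g * Pg MvPolynomial.X h) := by
  rw [chN, Pg_sumEmb]

theorem repro_left {N a b : ℕ} (hN : a ≤ N) (l : Partition') (h : Equiv.Perm (Fin b)) :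
    Repro N (fun g : Equiv.Perm (Fin a) => chN N l (sumEmb g h)) := by
  simp only [chN_sumEmb]
  exact repro_of hN (by simpa using hN) (MvPolynomial.X : Fin N → PN N)
    (Lf (pe N l) ∘ₗ LinearMap.mulRight ℚ (Pg MvPolynomial.X h : PN N))

theorem repro_right {N a b : ℕ} (hN : b ≤ N) (l : Partition') (g : Equiv.Perm (Fin a)) :
    Repro N (fun h : Equiv.Perm (Fin b) => chN N l (sumEmb g h)) := by
  simp only [chN_sumEmb]
  exact repro_of hN (by simpa using hN) (MvPolynomial.X : Fin N → PN N)
    (Lf (pe N l) ∘ₗ LinearMap.mulLeft ℚ (Pg MvPolynomial.X g : PN N))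

theorem fac_ne (n : ℕ) : (n.factorial : ℚ) ≠ 0 := by exact_mod_cast n.factorial_ne_zero

theorem lr_eq' {N a b : ℕ} (hN : a + b ≤ N) (l m nu : Partition') (hl : size l = a) (hm : size m = b) (hnu : size nu = a + b) :
    (a.factorial : ℚ) * (b.factorial : ℚ) * (lr l m nu : ℚ) =
    ∑ g : Equiv.Perm (Fin a), ∑ h : Equiv.Perm (Fin b),
      chN N l g * chN N m h * chN N nu (sumEmb g h) := by
  rw [lr_eq l m nu hl hm hnu]
  refine Finset.sum_congr rfl fun g _ => Finset.sum_congr rfl fun h _ => ?_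
  rw [irrChar_eq' N l g hl (by omega), irrChar_eq' N m h hm (by omega), irrChar_eq' N nu _ hnu hN]

theorem L1' {N a b : ℕ} (hN : a + b ≤ N) (rho nu : Partition') (hr : size rho = b) (hnu : size nu = a + b)
    (u : Equiv.Perm (Fin a)) :
    (b.factorial : ℚ) * ∑ τ ∈ Par a, (lr τ rho nu : ℚ) * chN N τ u =
      ∑ k : Equiv.Perm (Fin b), chN N rho k * chN N nu (sumEmb u k) := by
  apply mul_left_cancel₀ (fac_ne a)
  have h1 : ∀ k : Equiv.Perm (Fin b), (a.factorial : ℚ) * (chN N rho k * chN N nu (sumEmb u k)) =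
      ∑ τ ∈ Par a, ∑ g : Equiv.Perm (Fin a), chN N rho k * (chN N τ u * (chN N τ g * chN N nu (sumEmb g k))) := by
    intro k
    have := repro_left (N := N) (a := a) (by omega) nu k u
    rw [mul_left_comm, ← this, Finset.mul_sum]
    refine Finset.sum_congr rfl fun τ _ => ?_
    rw [Finset.mul_sum, Finset.mul_sum]
  conv_rhs => rw [Finset.mul_sum]
  simp only [h1]
  rw [Finset.sum_comm, Finset.mul_sum, Finset.mul_sum]
  refine Finset.sum_congr rfl fun τ hτ => ?_
  have h2 := lr_eq' hN τ rho nu (mem_Par.1 hτ) hr hnu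
  rw [← mul_assoc, ← mul_assoc, h2, Finset.sum_comm, Finset.sum_mul]
  refine Finset.sum_congr rfl fun k _ => ?_
  rw [Finset.sum_mul]
  refine Finset.sum_congr rfl fun g _ => ?_
  ring

theorem L1 {N a b : ℕ} (hN : a + b ≤ N) (nu : Partition') (hnu : size nu = a + b)
    (u : Equiv.Perm (Fin a)) (k : Equiv.Perm (Fin b)) :
    ∑ τ ∈ Par a, ∑ ρ ∈ Par b, (lr τ ρ nu : ℚ) * chN N τ u * chN N ρ k = chN N nu (sumEmb u k) := by
  apply mul_left_cancel₀ (fac_ne b)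
  have := repro_right (N := N) (b := b) (by omega) nu u k
  rw [← this, Finset.sum_comm, Finset.mul_sum]
  refine Finset.sum_congr rfl fun ρ hρ => ?_
  rw [← L1' hN ρ nu (mem_Par.1 hρ) hnu, ← Finset.sum_mul]
  ring

theorem L2 {N b : ℕ} (hN : b ≤ N) (β η : Partition') (hβ : size β = b) (hη : size η = b) (h : Equiv.Perm (Fin b)) :
    ∑ δ ∈ Par b, (kron β η δ : ℚ) * chN N δ h = chN N β h * chN N η h := by
  apply mul_left_cancel₀ (fac_ne b)
  have := repro_mul (n := b) hN β η h
  rw [← this, Finset.mul_sum]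
  refine Finset.sum_congr rfl fun δ hδ => ?_
  rw [← mul_assoc, kron_eq β η δ hβ hη (mem_Par.1 hδ), mul_comm]
  congr 1
  refine Finset.sum_congr rfl fun g _ => ?_
  rw [irrChar_eq' N β g hβ hN, irrChar_eq' N η g hη hN, irrChar_eq' N δ g (mem_Par.1 hδ) hN]
  ring

theorem L3 {N a b c : ℕ} (hN : a + b + c ≤ N) (α δ ρ nu : Partition') (hα : size α = a) (hδ : size δ = b)
    (hρ : size ρ = c) (hnu : size nu = a + b + c) :
    (a.factorial : ℚ) * b.factorial * c.factorial * ∑ τ ∈ Par (a + b), (lr α δ τ : ℚ) * lr τ ρ nu =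
    ∑ g : Equiv.Perm (Fin a), ∑ h : Equiv.Perm (Fin b), ∑ k : Equiv.Perm (Fin c),
      chN N α g * chN N δ h * chN N ρ k * chN N nu (sumEmb (sumEmb g h) k) := by
  have h1 : ∀ (g : Equiv.Perm (Fin a)) (h : Equiv.Perm (Fin b)), ∑ k : Equiv.Perm (Fin c),
      chN N α g * chN N δ h * chN N ρ k * chN N nu (sumEmb (sumEmb g h) k) =
      ∑ τ ∈ Par (a + b), (c.factorial : ℚ) * (lr τ ρ nu : ℚ) * (chN N α g * chN N δ h * chN N τ (sumEmb g h)) := by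
    intro g h
    have := L1' hN ρ nu hρ hnu (sumEmb g h)
    simp only [mul_assoc]
    rw [← Finset.mul_sum, ← Finset.mul_sum, ← this, Finset.mul_sum, Finset.mul_sum, Finset.mul_sum]
    refine Finset.sum_congr rfl fun τ _ => ?_
    ring
  simp only [h1]
  rw [Finset.mul_sum]
  have h2 : ∀ g : Equiv.Perm (Fin a), ∑ h : Equiv.Perm (Fin b), ∑ τ ∈ Par (a + b),
      (c.factorial : ℚ) * (lr τ ρ nu : ℚ) * (chN N α g * chN N δ h * chN N τ (sumEmb g h)) =
      ∑ τ ∈ Par (a + b), ∑ h : Equiv.Perm (Fin b),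
      (c.factorial : ℚ) * (lr τ ρ nu : ℚ) * (chN N α g * chN N δ h * chN N τ (sumEmb g h)) := fun g => Finset.sum_comm
  simp only [h2]
  rw [Finset.sum_comm]
  refine Finset.sum_congr rfl fun τ hτ => ?_
  simp only [← Finset.mul_sum]
  rw [← lr_eq' (by omega) α δ τ hα hδ (mem_Par.1 hτ)]
  ring

end AgS

open scoped BigOperators
open scoped Classical
open scoped TensorProduct

namespace AgS
open Partition'

theorem fsum_Par (F : Partition' → ℕ) (n : ℕ) (h : ∀ α, size α ≠ n → F α = 0) :
    ∑ᶠ α, F α = ∑ α ∈ Par n, F α := by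
  apply finsum_eq_sum_of_support_subset
  intro α hα
  rw [Function.mem_support] at hα
  rw [Finset.mem_coe, mem_Par]
  by_contra hc
  exact hα (h α hc)

noncomputable def agt (l m nu α β δ η ρ τ : Partition') : ℕ :=
  lr α β l * lr η ρ m * kron β η δ * lr α δ τ * lr τ ρ nu

theorem agt_ne {l m nu α β δ η ρ τ : Partition'} (h : agt l m nu α β δ η ρ τ ≠ 0) :
    size l = size α + size β ∧ size m = size β + size ρ ∧ size nu = size α + size β + size ρ ∧
    size δ = size β ∧ size η = size β ∧ size τ = size α + size β := by
  unfold agt at h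
  have h5 := right_ne_zero_of_mul h
  have h := left_ne_zero_of_mul h
  have h4 := right_ne_zero_of_mul h
  have h := left_ne_zero_of_mul h
  have h3 := right_ne_zero_of_mul h
  have h := left_ne_zero_of_mul h
  have h2 := right_ne_zero_of_mul h
  have h1 := left_ne_zero_of_mul h
  have key : ∀ x y z : Partition', lr x y z ≠ 0 → size z = size x + size y := by
    intro x y z hz
    by_contra hc
    rw [lr, if_neg hc] at hz
    exact hz rfl
  have key2 : size β = size δ ∧ size η = size δ := by
    by_contra hc
    rw [kron, if_neg hc] at h3
    exact h3 rfl
  have := key _ _ _ h1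
  have := key _ _ _ h2
  have := key _ _ _ h4
  have := key _ _ _ h5
  omega

theorem aguiar_zero (l m nu : Partition')
    (h : ¬ ∃ a b c, size l = a + b ∧ size m = b + c ∧ size nu = a + b + c) : aguiar l m nu = 0 := by
  have h0 : ∀ α β δ η ρ τ, agt l m nu α β δ η ρ τ = 0 := by
    intro α β δ η ρ τ
    by_contra hc
    have := agt_ne hc
    exact h ⟨size α, size β, size ρ, this.1, this.2.1, this.2.2.1⟩
  unfold aguiar
  unfold agt at h0
  simp [h0]

theorem aguiar_fin (l m nu : Partition') (a b c : ℕ) (hl : size l = a + b) (hm : size m = b + c)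
    (hnu : size nu = a + b + c) :
    aguiar l m nu = ∑ α ∈ Par a, ∑ β ∈ Par b, ∑ δ ∈ Par b, ∑ η ∈ Par b, ∑ ρ ∈ Par c, ∑ τ ∈ Par (a + b),
      agt l m nu α β δ η ρ τ := by
  have h0 : ∀ α β δ η ρ τ, (size α ≠ a ∨ size β ≠ b ∨ size δ ≠ b ∨ size η ≠ b ∨ size ρ ≠ c ∨ size τ ≠ a + b) →
      agt l m nu α β δ η ρ τ = 0 := by
    intro α β δ η ρ τ h
    by_contra hc
    have := agt_ne hc
    omega
  change (∑ᶠ (α : Partition') (β : Partition') (δ : Partition') (η : Partition')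
    (ρ : Partition') (τ : Partition'), agt l m nu α β δ η ρ τ) = _
  rw [fsum_Par _ a (fun α h => by simp [h0, h])]
  refine Finset.sum_congr rfl fun α _ => ?_
  rw [fsum_Par _ b (fun β h => by simp [h0, h])]
  refine Finset.sum_congr rfl fun β _ => ?_
  rw [fsum_Par _ b (fun δ h => by simp [h0, h])]
  refine Finset.sum_congr rfl fun δ _ => ?_
  rw [fsum_Par _ b (fun η h => by simp [h0, h])]
  refine Finset.sum_congr rfl fun η _ => ?_
  rw [fsum_Par _ c (fun ρ h => by simp [h0, h])]
  refine Finset.sum_congr rfl fun ρ _ => ?_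
  rw [fsum_Par _ (a + b) (fun τ h => by simp [h0, h])]

theorem aguiar_chars {N : ℕ} (l m nu : Partition') (a b c : ℕ) (hl : size l = a + b) (hm : size m = b + c)
    (hnu : size nu = a + b + c) (hN : a + b + c ≤ N) :
    (a.factorial : ℚ) * b.factorial * c.factorial * (aguiar l m nu : ℚ) =
    ∑ g : Equiv.Perm (Fin a), ∑ h : Equiv.Perm (Fin b), ∑ k : Equiv.Perm (Fin c),
      chN N l (sumEmb g h) * chN N m (sumEmb h k) * chN N nu (sumEmb (sumEmb g h) k) := by
  have hlr : ∀ (g : Equiv.Perm (Fin a)) (h : Equiv.Perm (Fin b)) (k : Equiv.Perm (Fin c)),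
      chN N l (sumEmb g h) * chN N m (sumEmb h k) * chN N nu (sumEmb (sumEmb g h) k) =
      ∑ α ∈ Par a, ∑ β ∈ Par b, ∑ δ ∈ Par b, ∑ η ∈ Par b, ∑ ρ ∈ Par c,
        ((lr α β l : ℚ) * lr η ρ m * kron β η δ) *
          (chN N α g * chN N δ h * chN N ρ k * chN N nu (sumEmb (sumEmb g h) k)) := by
    intro g h k
    rw [← L1 (by omega) l hl, ← L1 (by omega) m hm, Finset.sum_mul, Finset.sum_mul]
    refine Finset.sum_congr rfl fun α _ => ?_
    rw [Finset.sum_mul, Finset.sum_mul]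
    refine Finset.sum_congr rfl fun β hβ => ?_
    rw [Finset.mul_sum, Finset.sum_mul, Finset.sum_comm (s := Par b) (t := Par b)]
    refine Finset.sum_congr rfl fun η hη => ?_
    rw [Finset.mul_sum, Finset.sum_mul, Finset.sum_comm]
    refine Finset.sum_congr rfl fun ρ _ => ?_
    calc _ = (lr α β l : ℚ) * lr η ρ m * chN N α g * chN N ρ k * chN N nu (sumEmb (sumEmb g h) k) * (chN N β h * chN N η h) := by ring
      _ = _ := by
        rw [← L2 (by omega : b ≤ N) β η (mem_Par.1 hβ) (mem_Par.1 hη) h, Finset.mul_sum]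
        refine Finset.sum_congr rfl fun δ _ => ?_
        ring
  simp only [hlr]
  rw [aguiar_fin l m nu a b c hl hm hnu]
  have sw' : ∀ (s : Finset Partition') (F : Equiv.Perm (Fin a) → Equiv.Perm (Fin b) → Equiv.Perm (Fin c) → Partition' → ℚ),
      ∑ g, ∑ h, ∑ k, ∑ α ∈ s, F g h k α = ∑ α ∈ s, ∑ g, ∑ h, ∑ k, F g h k α := by
    intro s F
    simp only [← Fintype.sum_prod_type']
    rw [Finset.sum_comm]
  rw [sw']
  push_cast
  rw [Finset.mul_sum]
  refine Finset.sum_congr rfl fun α hα => ?_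
  rw [sw', Finset.mul_sum]
  refine Finset.sum_congr rfl fun β hβ => ?_
  rw [sw', Finset.mul_sum]
  refine Finset.sum_congr rfl fun δ hδ => ?_
  rw [sw', Finset.mul_sum]
  refine Finset.sum_congr rfl fun η hη => ?_
  rw [sw', Finset.mul_sum]
  refine Finset.sum_congr rfl fun ρ hρ => ?_
  simp only [← Finset.mul_sum]
  rw [← L3 hN α δ ρ nu (mem_Par.1 hα) (mem_Par.1 hδ) (mem_Par.1 hρ) hnu, mul_left_comm]
  congr 1
  rw [Finset.mul_sum]
  refine Finset.sum_congr rfl fun τ _ => ?_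
  simp only [agt]
  push_cast
  ring

/-- An algebra with three copies of the polynomial ring and the product functionals. -/
structure Tri (N : ℕ) (A : Type) [CommRing A] [Algebra ℚ A] where
  x : PN N →ₐ[ℚ] A
  y : PN N →ₐ[ℚ] A
  z : PN N →ₐ[ℚ] A
  LL : (Fin N → ℕ) → (Fin N → ℕ) → (Fin N → ℕ) → (A →ₗ[ℚ] ℚ)
  app : ∀ (α β γ : Fin N → ℕ) (p q r : PN N), LL α β γ (x p * y q * z r) = Lf α p * Lf β q * Lf γ r
  gen : Submodule.span ℚ {e : A | ∃ p q r : PN N, e = x p * y q * z r} = ⊤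

theorem exists_tri (N : ℕ) : ∃ (A : Type) (_ : CommRing A) (_ : Algebra ℚ A), Nonempty (Tri N A) := by
  refine ⟨PN N ⊗[ℚ] (PN N ⊗[ℚ] PN N), inferInstance, inferInstance, ⟨{
    x := Algebra.TensorProduct.includeLeft
    y := (Algebra.TensorProduct.includeRight : (PN N ⊗[ℚ] PN N) →ₐ[ℚ] (PN N ⊗[ℚ] (PN N ⊗[ℚ] PN N))).comp Algebra.TensorProduct.includeLeft
    z := (Algebra.TensorProduct.includeRight : (PN N ⊗[ℚ] PN N) →ₐ[ℚ] (PN N ⊗[ℚ] (PN N ⊗[ℚ] PN N))).comp Algebra.TensorProduct.includeRight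
    LL := fun α β γ => LinearMap.mul' ℚ ℚ ∘ₗ TensorProduct.map (Lf α) (LinearMap.mul' ℚ ℚ ∘ₗ TensorProduct.map (Lf β) (Lf γ))
    app := ?_
    gen := ?_ }⟩⟩
  · intro α β γ p q r
    simp [mul_assoc]
  · rw [eq_top_iff]
    rintro e -
    induction e using TensorProduct.induction_on with
    | zero => exact Submodule.zero_mem _
    | add a b ha hb => exact Submodule.add_mem _ ha hb
    | tmul p b =>
      induction b using TensorProduct.induction_on with
      | zero => rw [TensorProduct.tmul_zero]; exact Submodule.zero_mem _
      | add a b ha hb => rw [TensorProduct.tmul_add]; exact Submodule.add_mem _ ha hb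
      | tmul q r => exact Submodule.subset_span ⟨p, q, r, by simp⟩

section tri
variable {N : ℕ} {A : Type} [CommRing A] [Algebra ℚ A] (t : Tri N A)

noncomputable def Tri.vx (i : Fin N) : A := t.x (MvPolynomial.X i)
noncomputable def Tri.vy (i : Fin N) : A := t.y (MvPolynomial.X i)
noncomputable def Tri.vz (i : Fin N) : A := t.z (MvPolynomial.X i)

noncomputable def Tri.xz (p : Fin N × Fin N) : A := t.vx p.1 * t.vz p.2
noncomputable def Tri.yz (p : Fin N × Fin N) : A := t.vy p.1 * t.vz p.2
noncomputable def Tri.xyz (p : Fin N × (Fin N × Fin N)) : A := t.vx p.1 * t.yz p.2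

theorem aguiar_LL (l m nu : Partition') (a b c : ℕ) (hl : size l = a + b) (hm : size m = b + c)
    (hnu : size nu = a + b + c) (hN : a + b + c ≤ N) :
    (aguiar l m nu : ℚ) = t.LL (pe N l) (pe N m) (pe N nu)
      (hh Finset.univ t.xz a * hh Finset.univ t.xyz b * hh Finset.univ t.yz c) := by
  apply mul_left_cancel₀ (mul_ne_zero (mul_ne_zero (fac_ne a) (fac_ne b)) (fac_ne c))
  rw [aguiar_chars l m nu a b c hl hm hnu hN]
  have h1 : ∀ (g : Equiv.Perm (Fin a)) (h : Equiv.Perm (Fin b)) (k : Equiv.Perm (Fin c)),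
      chN N l (sumEmb g h) * chN N m (sumEmb h k) * chN N nu (sumEmb (sumEmb g h) k) =
      t.LL (pe N l) (pe N m) (pe N nu) (Pg t.xz g * Pg t.xyz h * Pg t.yz k) := by
    intro g h k
    have e1 : Pg t.xz g = Pg t.vx g * Pg t.vz g := (Pg_mul _ _ _).symm
    have e2 : Pg t.yz k = Pg t.vy k * Pg t.vz k := (Pg_mul _ _ _).symm
    have e3 : Pg t.xyz h = Pg t.vx h * (Pg t.vy h * Pg t.vz h) := by
      rw [Pg_mul t.vy, Pg_mul]; rfl
    have mx : ∀ {n : ℕ} (g : Equiv.Perm (Fin n)), Pg t.vx g = t.x (Pg MvPolynomial.X g) :=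
      fun g => (Pg_map (t.x).toRingHom MvPolynomial.X g).symm
    have my : ∀ {n : ℕ} (g : Equiv.Perm (Fin n)), Pg t.vy g = t.y (Pg MvPolynomial.X g) :=
      fun g => (Pg_map (t.y).toRingHom MvPolynomial.X g).symm
    have mz : ∀ {n : ℕ} (g : Equiv.Perm (Fin n)), Pg t.vz g = t.z (Pg MvPolynomial.X g) :=
      fun g => (Pg_map (t.z).toRingHom MvPolynomial.X g).symm
    have e4 : Pg t.xz g * Pg t.xyz h * Pg t.yz k =
        t.x (Pg MvPolynomial.X g * Pg MvPolynomial.X h) * t.y (Pg MvPolynomial.X h * Pg MvPolynomial.X k) *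
        t.z (Pg MvPolynomial.X g * Pg MvPolynomial.X h * Pg MvPolynomial.X k) := by
      simp only [map_mul, e1, e2, e3, mx, my, mz]
      ring
    rw [e4, t.app, chN_sumEmb, chN_sumEmb, chN_sumEmb, Pg_sumEmb]
  simp only [h1, ← map_sum]
  rw [← smul_eq_mul, ← map_smul]
  congr 1
  have h2 : (((a.factorial : ℚ) * b.factorial * c.factorial) •
      (hh Finset.univ t.xz a * hh Finset.univ t.xyz b * hh Finset.univ t.yz c)) =
      (a.factorial * hh Finset.univ t.xz a) * (b.factorial * hh Finset.univ t.xyz b) *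
      (c.factorial * hh Finset.univ t.yz c) := by
    rw [Algebra.smul_def]
    simp only [map_mul, map_natCast]
    ring
  rw [h2, ← sum_Pg, ← sum_Pg, ← sum_Pg, Finset.sum_mul_sum, Finset.sum_mul]
  refine Finset.sum_congr rfl fun g _ => ?_
  rw [Finset.sum_mul]
  refine Finset.sum_congr rfl fun h _ => ?_
  rw [Finset.mul_sum]

end tri

end AgS

open scoped BigOperators
open scoped Classical

namespace AgS
open Partition'

theorem hh_erase {S R : Type*} [DecidableEq S] [CommRing R] (s : Finset S) (w : S → R) (x : S) (hx : x ∈ s) (k : ℕ) :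
    hh s w (k + 1) = w x * hh s w k + hh (s.erase x) w (k + 1) := by
  have h1 : ∏ i ∈ s, geo (w i) = geo (w x) * ∏ i ∈ s.erase x, geo (w i) :=
    (Finset.mul_prod_erase s _ hx).symm
  have h2 : ∏ i ∈ s.erase x, geo (w i) = ∏ i ∈ s, geo (w i) - PowerSeries.C (w x) * ((∏ i ∈ s, geo (w i)) * PowerSeries.X) := by
    rw [h1]
    linear_combination (∏ i ∈ s.erase x, geo (w i)) * (- geo_mul (w x))
  have h3 := congrArg (PowerSeries.coeff (k + 1)) h2
  rw [map_sub, PowerSeries.coeff_C_mul, PowerSeries.coeff_succ_mul_X] at h3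
  simp only [hh]
  linear_combination - h3

theorem hh_mapE {S S' R : Type*} [CommRing R] (s : Finset S) (e : S ↪ S') (w : S' → R) (n : ℕ) :
    hh (s.map e) w n = hh s (fun i => w (e i)) n := by
  rw [hh, hh, Finset.prod_map]

theorem hh_split {S R : Type*} [DecidableEq S] [CommRing R] (s t : Finset S) (h : t ⊆ s) (w : S → R) (n : ℕ) :
    hh s w n = ∑ p ∈ Finset.HasAntidiagonal.antidiagonal n, hh t w p.1 * hh (s \ t) w p.2 := by
  rw [hh, ← Finset.prod_sdiff h, mul_comm, PowerSeries.coeff_mul]; rfl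

theorem Lf_shift {n : ℕ} (α : Fin (n + 1) → ℕ) (f : PN (n + 1)) :
    Lf (α + Pi.single 0 1) (MvPolynomial.X 0 * f) = Lf α f := by
  rw [Lf_apply, Lf_apply]
  have h1 : fs (α + Pi.single 0 1) = Finsupp.single 0 1 + fs α := by
    ext i
    rw [fs_apply, Finsupp.add_apply, fs_apply, Pi.add_apply, add_comm, Finsupp.single_apply, Pi.single_apply]
    congr! 2
    exact eq_comm
  rw [h1, mul_left_comm, MvPolynomial.coeff_X_mul]

theorem pe_shift {n : ℕ} (l : Partition') (d : ℕ) :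
    pe (n + 1) (l + row (d + 1)) = pe (n + 1) (l + row d) + Pi.single 0 1 := by
  funext i
  change l.1 i + (Finsupp.single 0 (d + 1) : ℕ →₀ ℕ) i + dl (n + 1) i =
    l.1 i + (Finsupp.single 0 d : ℕ →₀ ℕ) i + dl (n + 1) i + (Pi.single 0 1 : Fin (n + 1) → ℕ) i
  rw [Finsupp.single_apply, Finsupp.single_apply, Pi.single_apply]
  by_cases h : i = 0
  · subst h; simp; omega
  · have h' : ¬ (0 = (i : ℕ)) := fun hc => h (Fin.ext hc.symm)
    simp [h, h']

theorem Lf_dg {n : ℕ} (l : Partition') (f : PN (n + 1)) (h : f.degreeOf 0 < l.1 0) :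
    Lf (pe (n + 1) l) f = 0 := by
  rw [Lf_eq]
  refine Finset.sum_eq_zero fun σ _ => ?_
  have : MvPolynomial.coeff (fs fun i => pe (n + 1) l i - dl (n + 1) (σ i)) f = 0 := by
    rw [← MvPolynomial.notMem_support_iff]
    intro hc
    have := MvPolynomial.monomial_le_degreeOf 0 hc
    rw [fs_apply] at this
    simp only [pe, dl, Fin.val_zero] at this
    omega
  simp [this]

theorem sch_row {R : Type*} [CommRing R] {n : ℕ} (w : Fin (n + 1) → R) (t : ℕ) :
    sch w (dl (n + 1) + Pi.single 0 t) = hh Finset.univ w t := by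
  rw [sch, Matrix.det_of_isUpperTriangular]
  · rw [Fin.prod_univ_succ]
    rw [Finset.prod_eq_one]
    · simp [JTm]
    · intro i _
      simp [JTm, hh_zero]
  · intro i j hij
    have hij : j < i := hij
    have h0 : i ≠ 0 := fun hc => by subst hc; exact absurd hij (Fin.not_lt_zero _)
    simp only [JTm, Matrix.of_apply]
    rw [if_neg]
    simp only [Pi.add_apply, Pi.single_apply, h0, if_false, dl]
    have := Fin.lt_def.1 hij
    omega

theorem alt_row {R : Type*} [CommRing R] {n : ℕ} (w : Fin (n + 1) → R) (t : ℕ) :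
    alt w (dl (n + 1) + Pi.single 0 t) = alt w (dl (n + 1)) * hh Finset.univ w t := by
  rw [← sch_row, ← alt_eq]

theorem alt_hbar {R : Type*} [CommRing R] {n : ℕ} (w : Fin (n + 1) → R) (t : ℕ)
    (h : ∀ i, i ≠ 0 → w i ^ (n + t) = 0) :
    alt w (dl (n + 1)) * hh (Finset.univ.erase 0) w (t + 1) = 0 := by
  have h1 := hh_erase Finset.univ w 0 (Finset.mem_univ _) t
  have h2 : alt w (dl (n + 1)) * hh (Finset.univ.erase 0) w (t + 1) =
      alt w (dl (n + 1) + Pi.single 0 (t + 1)) - w 0 * alt w (dl (n + 1) + Pi.single 0 t) := by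
    rw [alt_row, alt_row, h1]
    ring
  rw [h2, alt_apply, alt_apply, Finset.mul_sum, ← Finset.sum_sub_distrib]
  refine Finset.sum_eq_zero fun σ _ => ?_
  by_cases hσ : σ 0 = 0
  · have h3 : ∏ i, w i ^ (dl (n + 1) + Pi.single 0 (t + 1) : Fin (n + 1) → ℕ) (σ i) =
        w 0 * ∏ i, w i ^ (dl (n + 1) + Pi.single 0 t : Fin (n + 1) → ℕ) (σ i) := by
      rw [Fin.prod_univ_succ, Fin.prod_univ_succ, ← mul_assoc]
      congr 1
      · simp only [hσ, Pi.add_apply, Pi.single_eq_same]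
        rw [← add_assoc, pow_succ, mul_comm]
      · refine Finset.prod_congr rfl fun i _ => ?_
        have : σ i.succ ≠ 0 := by
          rw [← hσ]
          exact fun hc => Fin.succ_ne_zero i (σ.injective hc)
        simp [this]
    rw [h3]; ring
  · have hk : σ.symm 0 ≠ 0 := by
      intro hc
      apply hσ
      rw [← hc, Equiv.apply_symm_apply, hc]
    have h4 : ∀ s, t ≤ s → ∏ i, w i ^ (dl (n + 1) + Pi.single 0 s : Fin (n + 1) → ℕ) (σ i) = 0 := by
      intro s hs
      apply Finset.prod_eq_zero (Finset.mem_univ (σ.symm 0))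
      rw [Equiv.apply_symm_apply]
      simp only [Pi.add_apply, Pi.single_eq_same, dl, Fin.val_zero]
      exact pow_eq_zero_of_le (by omega) (h _ hk)
    rw [h4 _ (Nat.le_succ t), h4 _ le_rfl]
    ring

theorem coeff_span {N : ℕ} (s : Set (Fin N)) (k : ℕ) (f : PN N) (m : Fin N →₀ ℕ) (hm : ∀ i ∈ s, m i < k)
    (hf : f ∈ Ideal.span ((fun i => (MvPolynomial.X i : PN N) ^ k) '' s)) : MvPolynomial.coeff m f = 0 := by
  induction hf using Submodule.span_induction generalizing m with
  | mem x hx =>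
    obtain ⟨i, hi, rfl⟩ := hx
    simp only [MvPolynomial.coeff_X_pow]
    rw [if_neg]
    rintro rfl
    have := hm i hi
    simp at this
  | zero => simp
  | add x y _ _ hx hy => rw [MvPolynomial.coeff_add, hx m hm, hy m hm, add_zero]
  | smul a x _ hx =>
    rw [smul_eq_mul, MvPolynomial.coeff_mul]
    refine Finset.sum_eq_zero fun p hp => ?_
    rw [hx p.2, mul_zero]
    intro i hi
    have := Finset.HasAntidiagonal.mem_antidiagonal.1 hp
    have h2 := hm i hi
    rw [← this, Finsupp.add_apply] at h2
    omega

noncomputable def hbar (n t : ℕ) : PN (n + 1) := hh (Finset.univ.erase 0) MvPolynomial.X t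

theorem Lf_hbar {n : ℕ} (l : Partition') (f : PN (n + 1)) (t : ℕ) (h : l.1 1 < t) :
    Lf (pe (n + 1) l) (f * hbar n t) = 0 := by
  obtain ⟨t, rfl⟩ : ∃ s, t = s + 1 := ⟨t - 1, by omega⟩
  rw [Lf_apply, mul_left_comm]
  refine coeff_span {i | i ≠ 0} (n + t) _ _ ?_ ?_
  · intro i hi
    have hi : i ≠ 0 := hi
    have h0 : 1 ≤ (i : ℕ) := Nat.one_le_iff_ne_zero.2 fun hc => hi (Fin.ext hc)
    have h1 : l.1 i ≤ l.1 1 := l.2 h0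
    rw [fs_apply]
    simp only [pe, dl]
    have := i.2
    omega
  · apply Ideal.mul_mem_left
    rw [← Ideal.Quotient.eq_zero_iff_mem, map_mul, alt_map, hbar, hh_map]
    apply alt_hbar
    intro i hi
    rw [← map_pow, Ideal.Quotient.eq_zero_iff_mem]
    exact Ideal.subset_span ⟨i, hi, rfl⟩

theorem degreeOf_hbar (n t : ℕ) : (hbar n t).degreeOf 0 = 0 := by
  rw [hbar, hh_eq]
  rw [← Nat.le_zero]
  refine (MvPolynomial.degreeOf_sum_le _ _ _).trans (Finset.sup_le fun m _ => ?_)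
  refine (MvPolynomial.degreeOf_prod_le _ _ _).trans (le_of_eq (Finset.sum_eq_zero fun i hi => ?_))
  rw [← Nat.le_zero]
  refine (MvPolynomial.degreeOf_pow_le _ _ _).trans ?_
  rw [MvPolynomial.degreeOf_X, if_neg (Finset.ne_of_mem_erase hi).symm, mul_zero]

end AgS

open scoped BigOperators
open scoped Classical

namespace AgS
open Partition'

section tri
variable {n : ℕ} {A : Type} [CommRing A] [Algebra ℚ A] (t : Tri (n + 1) A)

/-- span of products with total degree at most `k` in the index zero variables -/
noncomputable def Tri.Q (k : ℕ) : Submodule ℚ A :=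
  Submodule.span ℚ {e | ∃ p q r : PN (n + 1), p.degreeOf 0 + q.degreeOf 0 + r.degreeOf 0 ≤ k ∧
    e = t.x p * t.y q * t.z r}

theorem Q_mul {j k : ℕ} {e f : A} (he : e ∈ t.Q j) (hf : f ∈ t.Q k) : e * f ∈ t.Q (j + k) := by
  have h := Submodule.mul_mem_mul he hf
  rw [Tri.Q, Tri.Q, Submodule.span_mul_span] at h
  refine Submodule.span_mono ?_ h
  rintro _ ⟨_, ⟨p, q, r, h1, rfl⟩, _, ⟨p', q', r', h2, rfl⟩, rfl⟩
  refine ⟨p * p', q * q', r * r', ?_, ?_⟩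
  · have := MvPolynomial.degreeOf_mul_le 0 p p'
    have := MvPolynomial.degreeOf_mul_le 0 q q'
    have := MvPolynomial.degreeOf_mul_le 0 r r'
    omega
  · simp only [map_mul]; ring

theorem Q_mono {j k : ℕ} (h : j ≤ k) {e : A} (he : e ∈ t.Q j) : e ∈ t.Q k := by
  refine Submodule.span_mono ?_ he
  rintro _ ⟨p, q, r, h1, rfl⟩
  exact ⟨p, q, r, h1.trans h, rfl⟩

theorem Q_one : (1 : A) ∈ t.Q 0 :=
  Submodule.subset_span ⟨1, 1, 1, by simp, by simp⟩

theorem Q_pow {k : ℕ} {e : A} (he : e ∈ t.Q k) (m : ℕ) : e ^ m ∈ t.Q (k * m) := by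
  induction m with
  | zero => simpa using Q_one t
  | succ m ih => rw [pow_succ, Nat.mul_succ]; exact Q_mul t ih he

theorem Q_hh {S : Type*} (s : Finset S) (w : S → A) (k m : ℕ) (h : ∀ i ∈ s, w i ∈ t.Q k) :
    hh s w m ∈ t.Q (k * m) := by
  rw [hh_eq]
  refine Submodule.sum_mem _ fun c hc => ?_
  have hs : ∑ i ∈ s, c i = m := (Finset.mem_finsuppAntidiag.1 hc).1
  rw [← hs]
  have : ∀ u ⊆ s, ∏ i ∈ u, w i ^ c i ∈ t.Q (k * ∑ i ∈ u, c i) := by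
    intro u
    induction u using Finset.induction_on with
    | empty => intro _; simpa using Q_one t
    | insert a u ha ih =>
      intro hu
      rw [Finset.prod_insert ha, Finset.sum_insert ha, mul_add]
      exact Q_mul t (Q_pow t (h a (hu (Finset.mem_insert_self _ _))) _)
        (ih fun i hi => hu (Finset.mem_insert_of_mem hi))
  exact this s subset_rfl

theorem Q_vx (i : Fin (n + 1)) : t.vx i ∈ t.Q (if i = 0 then 1 else 0) :=
  Submodule.subset_span ⟨MvPolynomial.X i, 1, 1, by simp [MvPolynomial.degreeOf_X, eq_comm], by simp [Tri.vx]⟩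
theorem Q_vy (i : Fin (n + 1)) : t.vy i ∈ t.Q (if i = 0 then 1 else 0) :=
  Submodule.subset_span ⟨1, MvPolynomial.X i, 1, by simp [MvPolynomial.degreeOf_X, eq_comm], by simp [Tri.vy]⟩
theorem Q_vz (i : Fin (n + 1)) : t.vz i ∈ t.Q (if i = 0 then 1 else 0) :=
  Submodule.subset_span ⟨1, 1, MvPolynomial.X i, by simp [MvPolynomial.degreeOf_X, eq_comm], by simp [Tri.vz]⟩

theorem Q1x (i : Fin (n + 1)) : t.vx i ∈ t.Q 1 :=
  Q_mono t (by split_ifs <;> omega) (Q_vx t i)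

theorem Q1y (i : Fin (n + 1)) : t.vy i ∈ t.Q 1 :=
  Q_mono t (by split_ifs <;> omega) (Q_vy t i)

theorem Q1z (i : Fin (n + 1)) : t.vz i ∈ t.Q 1 :=
  Q_mono t (by split_ifs <;> omega) (Q_vz t i)

theorem Q_xz (i : Fin (n + 1) × Fin (n + 1)) : t.xz i ∈ t.Q 2 := by
  have h := Q_mul t (Q1x t i.1) (Q1z t i.2)
  rw [one_add_one_eq_two] at h
  exact h

theorem Q_yz (i : Fin (n + 1) × Fin (n + 1)) : t.yz i ∈ t.Q 2 := by
  have h := Q_mul t (Q1y t i.1) (Q1z t i.2)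
  rw [one_add_one_eq_two] at h
  exact h

theorem LL_vanish (l m nu : Partition') (p q r k : ℕ) (e : A) (he : e ∈ t.Q k)
    (h : p ≤ l.1 1 → q ≤ m.1 1 → r ≤ nu.1 1 → k < l.1 0 + m.1 0 + nu.1 0) :
    t.LL (pe (n + 1) l) (pe (n + 1) m) (pe (n + 1) nu)
      (e * (t.x (hbar n p) * t.y (hbar n q) * t.z (hbar n r))) = 0 := by
  induction he using Submodule.span_induction with
  | mem e he =>
    obtain ⟨f, g, h', hk, rfl⟩ := he
    have e1 : t.x f * t.y g * t.z h' * (t.x (hbar n p) * t.y (hbar n q) * t.z (hbar n r)) =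
        t.x (f * hbar n p) * t.y (g * hbar n q) * t.z (h' * hbar n r) := by
      simp only [map_mul]; ring
    rw [e1, t.app]
    by_cases hp : l.1 1 < p
    · rw [Lf_hbar l f p hp]; ring
    by_cases hq : m.1 1 < q
    · rw [Lf_hbar m g q hq]; ring
    by_cases hr : nu.1 1 < r
    · rw [Lf_hbar nu h' r hr]; ring
    have hh := h (by omega) (by omega) (by omega)
    have key : ∀ (f : PN (n + 1)) (t : ℕ), (f * hbar n t).degreeOf 0 ≤ f.degreeOf 0 := fun f t => by
      have := MvPolynomial.degreeOf_mul_le 0 f (hbar n t)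
      rwa [degreeOf_hbar, add_zero] at this
    have k1 := key f p
    have k2 := key g q
    have k3 := key h' r
    by_cases h1 : f.degreeOf 0 < l.1 0
    · rw [Lf_dg l _ (by omega)]; ring
    by_cases h2 : g.degreeOf 0 < m.1 0
    · rw [Lf_dg m _ (by omega)]; ring
    rw [Lf_dg nu _ (by omega)]; ring
  | zero => simp
  | add e f _ _ h1 h2 => rw [add_mul, map_add, h1, h2, add_zero]
  | smul c e _ h1 => rw [smul_mul_assoc, map_smul, h1, smul_zero]

noncomputable def eX (n : ℕ) : Fin (n + 1) ↪ Fin (n + 1) × (Fin (n + 1) × Fin (n + 1)) :=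
  ⟨fun i => (i, (0, 0)), fun i j h => by simpa using h⟩
noncomputable def eY (n : ℕ) : Fin (n + 1) ↪ Fin (n + 1) × (Fin (n + 1) × Fin (n + 1)) :=
  ⟨fun i => (0, (i, 0)), fun i j h => by simpa using h⟩
noncomputable def eZ (n : ℕ) : Fin (n + 1) ↪ Fin (n + 1) × (Fin (n + 1) × Fin (n + 1)) :=
  ⟨fun i => (0, (0, i)), fun i j h => by simpa using h⟩

theorem eX_apply (i : Fin (n + 1)) : eX n i = (i, (0, 0)) := rfl
theorem eY_apply (i : Fin (n + 1)) : eY n i = (0, (i, 0)) := rfl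
theorem eZ_apply (i : Fin (n + 1)) : eZ n i = (0, (0, i)) := rfl

theorem hh_eX (p : ℕ) : hh ((Finset.univ.erase 0).map (eX n)) t.xyz p =
    (t.vy 0 * t.vz 0) ^ p * t.x (hbar n p) := by
  rw [hh_mapE]
  have : t.x (hbar n p) = hh (Finset.univ.erase 0) t.vx p := hh_map t.x.toRingHom _ _ _
  rw [this, ← hh_smul]
  congr 1
  funext i
  change t.vx i * (t.vy 0 * t.vz 0) = _
  ring

theorem hh_eY (p : ℕ) : hh ((Finset.univ.erase 0).map (eY n)) t.xyz p =
    (t.vx 0 * t.vz 0) ^ p * t.y (hbar n p) := by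
  rw [hh_mapE]
  have : t.y (hbar n p) = hh (Finset.univ.erase 0) t.vy p := hh_map t.y.toRingHom _ _ _
  rw [this, ← hh_smul]
  congr 1
  funext i
  change t.vx 0 * (t.vy i * t.vz 0) = _
  ring

theorem hh_eZ (p : ℕ) : hh ((Finset.univ.erase 0).map (eZ n)) t.xyz p =
    (t.vx 0 * t.vy 0) ^ p * t.z (hbar n p) := by
  rw [hh_mapE]
  have : t.z (hbar n p) = hh (Finset.univ.erase 0) t.vz p := hh_map t.z.toRingHom _ _ _
  rw [this, ← hh_smul]
  congr 1
  funext i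
  change t.vx 0 * (t.vy 0 * t.vz i) = _
  ring

noncomputable def WW (n : ℕ) : Finset (Fin (n + 1) × (Fin (n + 1) × Fin (n + 1))) :=
  (((Finset.univ.erase 0) \ (Finset.univ.erase 0).map (eX n)) \ (Finset.univ.erase 0).map (eY n)) \
    (Finset.univ.erase 0).map (eZ n)

theorem Q_WW (i : Fin (n + 1) × (Fin (n + 1) × Fin (n + 1))) (hi : i ∈ WW n) : t.xyz i ∈ t.Q 1 := by
  obtain ⟨i, j, k⟩ := i
  simp only [WW, Finset.mem_sdiff, Finset.mem_erase, Finset.mem_map, Finset.mem_univ, and_true,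
    eX_apply, eY_apply, eZ_apply, Prod.mk.injEq, not_exists, not_and, ne_eq, Prod.mk_eq_zero] at hi
  obtain ⟨⟨⟨h0, h1⟩, h2⟩, h3⟩ := hi
  have := Q_mul t (Q_vx t i) (Q_mul t (Q_vy t j) (Q_vz t k))
  refine Q_mono t ?_ this
  have h1 := h1 i
  have h2 := h2 j
  have h3 := h3 k
  clear this
  by_cases a : i = 0 <;> by_cases b : j = 0 <;> by_cases c : k = 0 <;> simp_all

theorem hh_decomp (b : ℕ) : hh (Finset.univ.erase 0) t.xyz b =
    ∑ p ∈ Finset.HasAntidiagonal.antidiagonal b, ∑ q ∈ Finset.HasAntidiagonal.antidiagonal p.2,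
      ∑ r ∈ Finset.HasAntidiagonal.antidiagonal q.2,
      ((t.vy 0 * t.vz 0) ^ p.1 * t.x (hbar n p.1)) * (((t.vx 0 * t.vz 0) ^ q.1 * t.y (hbar n q.1)) *
        (((t.vx 0 * t.vy 0) ^ r.1 * t.z (hbar n r.1)) * hh (WW n) t.xyz r.2)) := by
  rw [hh_split _ ((Finset.univ.erase 0).map (eX n))]
  · refine Finset.sum_congr rfl fun p _ => ?_
    rw [hh_split (Finset.univ.erase 0 \ (Finset.univ.erase 0).map (eX n)) ((Finset.univ.erase 0).map (eY n)), Finset.mul_sum]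
    · refine Finset.sum_congr rfl fun q _ => ?_
      rw [hh_split ((Finset.univ.erase 0 \ (Finset.univ.erase 0).map (eX n)) \ (Finset.univ.erase 0).map (eY n)) ((Finset.univ.erase 0).map (eZ n)), Finset.mul_sum, Finset.mul_sum]
      · refine Finset.sum_congr rfl fun r _ => ?_
        rw [hh_eX, hh_eY, hh_eZ]; rfl
      · intro i hi
        obtain ⟨j, hj, rfl⟩ := Finset.mem_map.1 hi
        have hj := Finset.ne_of_mem_erase hj
        simp [eX_apply, eY_apply, eZ_apply, hj, Ne.symm hj]
    · intro i hi
      obtain ⟨j, hj, rfl⟩ := Finset.mem_map.1 hi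
      have hj := Finset.ne_of_mem_erase hj
      simp [eX_apply, eY_apply, eZ_apply, hj, Ne.symm hj]
  · intro i hi
    obtain ⟨j, hj, rfl⟩ := Finset.mem_map.1 hi
    have hj := Finset.ne_of_mem_erase hj
    simp [eX_apply, eY_apply, eZ_apply, hj, Ne.symm hj]

theorem ringid (a c p x q y r z : A) : ∀ w : A, a * (p * x * (q * y * (r * z * w))) * c =
    a * c * w * p * q * r * (x * y * z) := by
  intro w
  ring

theorem vanish (l m nu : Partition') (a b c : ℕ)
    (h : 2 * a + b + 2 * c + l.1 1 + m.1 1 + nu.1 1 < l.1 0 + m.1 0 + nu.1 0) :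
    t.LL (pe (n + 1) l) (pe (n + 1) m) (pe (n + 1) nu)
      (hh Finset.univ t.xz a * hh (Finset.univ.erase 0) t.xyz b * hh Finset.univ t.yz c) = 0 := by
  rw [hh_decomp]
  simp only [Finset.mul_sum, Finset.sum_mul, map_sum]
  refine Finset.sum_eq_zero fun p hp => Finset.sum_eq_zero fun q hq => Finset.sum_eq_zero fun r hr => ?_
  have hp := Finset.HasAntidiagonal.mem_antidiagonal.1 hp
  have hq := Finset.HasAntidiagonal.mem_antidiagonal.1 hq
  have hr := Finset.HasAntidiagonal.mem_antidiagonal.1 hr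
  have q1 : hh Finset.univ t.xz a ∈ t.Q (2 * a) :=
    Q_hh t _ _ _ _ fun i _ => Q_xz t i
  have q2 : hh Finset.univ t.yz c ∈ t.Q (2 * c) :=
    Q_hh t _ _ _ _ fun i _ => Q_yz t i
  have q3 : hh (WW n) t.xyz r.2 ∈ t.Q (1 * r.2) := Q_hh t _ _ _ _ fun i hi => Q_WW t i hi
  have x0 : t.vx 0 ∈ t.Q 1 := Q1x t 0
  have y0 : t.vy 0 ∈ t.Q 1 := Q1y t 0
  have z0 : t.vz 0 ∈ t.Q 1 := Q1z t 0
  have q4 := Q_pow t (Q_mul t y0 z0) p.1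
  have q5 := Q_pow t (Q_mul t x0 z0) q.1
  have q6 := Q_pow t (Q_mul t x0 y0) r.1
  have q7 := Q_mul t (Q_mul t (Q_mul t (Q_mul t (Q_mul t q1 q2) q3) q4) q5) q6
  have := LL_vanish t l m nu p.1 q.1 r.1 _ _ q7 (fun h1 h2 h3 => by omega)
  rw [← this]
  exact congrArg _ (ringid _ _ _ _ _ _ _ _ _)

theorem LL_shift (α β γ : Fin (n + 1) → ℕ) (e : A) :
    t.LL (α + Pi.single 0 1) (β + Pi.single 0 1) (γ + Pi.single 0 1) (t.xyz 0 * e) = t.LL α β γ e := by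
  have he : e ∈ Submodule.span ℚ {e : A | ∃ p q r : PN (n + 1), e = t.x p * t.y q * t.z r} := by
    rw [t.gen]; trivial
  induction he using Submodule.span_induction with
  | mem e he =>
    obtain ⟨p, q, r, rfl⟩ := he
    have : t.xyz 0 * (t.x p * t.y q * t.z r) = t.x (MvPolynomial.X 0 * p) * t.y (MvPolynomial.X 0 * q) * t.z (MvPolynomial.X 0 * r) := by
      simp only [map_mul]
      change t.vx 0 * (t.vy 0 * t.vz 0) * _ = t.vx 0 * _ * (t.vy 0 * _) * (t.vz 0 * _)
      ring
    rw [this, t.app, t.app, Lf_shift, Lf_shift, Lf_shift]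
  | zero => simp
  | add e f _ _ h1 h2 => rw [mul_add, map_add, h1, h2, map_add]
  | smul c e _ h1 => rw [mul_smul_comm, map_smul, h1, map_smul]

end tri

end AgS

open scoped BigOperators
open scoped Classical

namespace AgS
open Partition'

theorem size_row (l : Partition') (d : ℕ) : size (l + row d) = size l + d := by
  change (l.1 + Finsupp.single 0 d).sum (fun _ v => v) = l.1.sum (fun _ v => v) + d
  rw [Finsupp.sum_add_index' (fun _ => rfl) (fun _ _ _ => rfl), Finsupp.sum_single_index rfl]

theorem row_zero (l : Partition') (d : ℕ) : (l + row d).1 0 = l.1 0 + d := by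
  change l.1 0 + (Finsupp.single 0 d : ℕ →₀ ℕ) 0 = _
  simp

theorem row_one (l : Partition') (d : ℕ) : (l + row d).1 1 = l.1 1 := by
  change l.1 1 + (Finsupp.single 0 d : ℕ →₀ ℕ) 1 = _
  simp

theorem main_aux (l m nu : Partition') (d : ℕ)
    (hd : 3 * (size nu : ℤ) - size l - size m - l.1 0 - m.1 0 - nu.1 0
        + l.1 1 + m.1 1 + nu.1 1 - 1 ≤ 2 * d) :
    aguiar (l + row d) (m + row d) (nu + row d) =
      aguiar (l + row (d + 1)) (m + row (d + 1)) (nu + row (d + 1)) := by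
  by_cases hE : ∃ a b c, size (l + row (d + 1)) = a + b ∧ size (m + row (d + 1)) = b + c ∧
      size (nu + row (d + 1)) = a + b + c
  swap
  · rw [aguiar_zero _ _ _ hE, aguiar_zero]
    rintro ⟨a, b, c, h1, h2, h3⟩
    simp only [size_row] at *
    exact hE ⟨a, b + 1, c, by omega, by omega, by omega⟩
  obtain ⟨a, b, c, h1, h2, h3⟩ := hE
  obtain ⟨A, _, _, ⟨t⟩⟩ := exists_tri (a + b + c + 1)
  have hv := vanish t (l + row (d + 1)) (m + row (d + 1)) (nu + row (d + 1)) a b c (by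
    simp only [size_row, row_zero, row_one] at *
    omega)
  rw [← Nat.cast_inj (R := ℚ), aguiar_LL t _ _ _ a b c h1 h2 h3 (by omega)]
  rcases b with _ | b
  · rw [hh_zero] at hv ⊢
    rw [hv, aguiar_zero, Nat.cast_zero]
    rintro ⟨a', b', c', h1', h2', h3'⟩
    simp only [size_row] at *
    omega
  · rw [aguiar_LL t (l + row d) (m + row d) (nu + row d) a b c (by rw [size_row] at *; omega)
      (by rw [size_row] at *; omega) (by rw [size_row] at *; omega) (by omega)]
    rw [hh_erase Finset.univ t.xyz 0 (Finset.mem_univ _) b, mul_add, add_mul, map_add, hv, add_zero,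
      pe_shift, pe_shift, pe_shift, ← LL_shift t]
    congr 1
    ring

end AgS

open Partition' in
/-- For all partitions `λ, μ, ν` and every
`d ≥ (3|ν| − |λ| − |μ| − λ₁ − μ₁ − ν₁ + λ₂ + μ₂ + ν₂ − 1)/2`, the Aguiar coefficients
satisfy `a_{λ+(d),μ+(d)}^{ν+(d)} = a_{λ+(d+1),μ+(d+1)}^{ν+(d+1)}`. -/
theorem aguiar_stable_ying_bound (l m nu : Partition') (d : ℕ)
    (hd : 3 * (size nu : ℤ) - size l - size m - l.1 0 - m.1 0 - nu.1 0
        + l.1 1 + m.1 1 + nu.1 1 - 1 ≤ 2 * d) :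
    aguiar (l + row d) (m + row d) (nu + row d) =
      aguiar (l + row (d + 1)) (m + row (d + 1)) (nu + row (d + 1)) := 
  AgS.main_aux l m nu d hd
end

section
/- For partitions λ of k and μ of l, the top component a_{λ,μ}^ν for |ν| = k + l equals the Littlewood–Richardson coefficient c_{λ,μ}^ν; that is, Σ_{α,β,δ,η,ρ,τ} c_{α,β}^λ c_{η,ρ}^μ g_{β,η,δ} c_{α,δ}^τ c_{τ,ρ}^ν = c_{λ,μ}^ν whenever |ν| = |λ| + |μ|. -/
open scoped BigOperators
open scoped Classical

namespace Partition'

/-- homogeneous expansion -/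
lemma homog_expand {R : Type*} [CommRing R] {n : ℕ} (x : Fin n → R) (i : Fin n) (s t : R) :
    ∏ k ∈ Finset.univ.erase i, (s - x k * t) =
      ∑ j : Fin n, (∑ T ∈ Finset.powersetCard (j : ℕ) (Finset.univ.erase i),
        ∏ k ∈ (Finset.univ.erase i) \ T, (- x k)) * (s ^ (j : ℕ) * t ^ (j.rev : ℕ)) := by
  have hn : (Finset.univ.erase i).card + 1 = n := by
    rw [Finset.card_erase_add_one (Finset.mem_univ i)]; simp
  have h1 : ∏ k ∈ Finset.univ.erase i, (s - x k * t) =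
      ∏ k ∈ Finset.univ.erase i, (s + (- x k) * t) := by
    apply Finset.prod_congr rfl; intros; ring
  rw [h1, Finset.prod_add, Finset.sum_powerset, hn, Finset.sum_range]
  apply Finset.sum_congr rfl
  intro j _
  rw [Finset.sum_mul]
  apply Finset.sum_congr rfl
  intro T hT
  rw [Finset.mem_powersetCard] at hT
  rw [Finset.prod_const, Finset.prod_mul_distrib, Finset.prod_const, Finset.card_sdiff_of_subset hT.1,
    hT.2]
  have : (j.rev : ℕ) = (Finset.univ.erase i).card - (j : ℕ) := by
    rw [Fin.val_rev]; omega
  rw [this]; ring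

lemma prod_erase_eq {R : Type*} [CommRing R] {n : ℕ} (x : Fin n → R) :
    ∏ i, ∏ k ∈ Finset.univ.erase i, (x i - x k) =
      (∏ i, ∏ j ∈ Finset.Ioi i, (x i - x j)) * (∏ i, ∏ j ∈ Finset.Ioi i, (x j - x i)) := by
  have h2 : (∏ i, ∏ j ∈ Finset.Ioi i, (x j - x i)) = ∏ i, ∏ j ∈ Finset.Iio i, (x i - x j) := by
    apply Finset.prod_comm'
    simp
  rw [h2, ← Finset.prod_mul_distrib]
  apply Finset.prod_congr rfl
  intro i _
  rw [← Finset.prod_union]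
  · apply Finset.prod_congr _ (fun _ _ => rfl)
    ext k; simp only [Finset.mem_erase, Finset.mem_univ, Finset.mem_union, Finset.mem_Ioi,
      Finset.mem_Iio]; rw [ne_iff_lt_or_gt]; tauto
  · rw [Finset.disjoint_left]; intro k; simp only [Finset.mem_Ioi, Finset.mem_Iio]
    intro h; exact not_lt.2 h.le

lemma det_A {R : Type*} [CommRing R] [IsDomain R] {n : ℕ} (x y : Fin n → R)
    (hx : Function.Injective x) :
    (Matrix.of fun i j => ∏ k ∈ Finset.univ.erase i, (1 - x k * y j)).det =
      (Matrix.projVandermonde 1 x).det * (Matrix.projVandermonde 1 y).det := by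
  set C : Matrix (Fin n) (Fin n) R := Matrix.of fun i j =>
    (∑ T ∈ Finset.powersetCard (j : ℕ) (Finset.univ.erase i),
        ∏ k ∈ (Finset.univ.erase i) \ T, (- x k)) with hC
  have hgen : ∀ s t : Fin n → R, (Matrix.of fun i j => ∏ k ∈ Finset.univ.erase i, (s j - x k * t j))
      = C * (Matrix.projVandermonde s t).transpose := by
    intro s t
    ext i j
    rw [Matrix.of_apply, homog_expand, Matrix.mul_apply]
    rfl
  have h1 := congrArg Matrix.det (hgen 1 y)
  have h2 := congrArg Matrix.det (hgen x 1)
  rw [Matrix.det_mul, Matrix.det_transpose] at h1 h2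
  have h3 : (Matrix.of fun i j => ∏ k ∈ Finset.univ.erase i, (x j - x k * (1 : Fin n → R) j)) =
      Matrix.diagonal (fun i => ∏ k ∈ Finset.univ.erase i, (x i - x k)) := by
    ext i j
    rw [Matrix.of_apply, Matrix.diagonal_apply]
    split_ifs with h
    · subst h; simp
    · apply Finset.prod_eq_zero (i := j)
      · simp [Ne.symm h]
      · simp
  rw [h3, Matrix.det_diagonal, prod_erase_eq, Matrix.det_projVandermonde] at h2
  have h4 : (∏ i, ∏ j ∈ Finset.Ioi i, (x j - x i)) ≠ 0 := by
    rw [← Matrix.det_vandermonde]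
    exact Matrix.det_vandermonde_ne_zero_iff.2 hx
  have h5 : C.det = (Matrix.projVandermonde 1 x).det := by
    rw [Matrix.det_projVandermonde]
    apply mul_right_cancel₀ h4
    simpa using h2.symm
  rw [← h5]
  exact h1

/-- Cauchy determinant -/
lemma det_G {R : Type*} [CommRing R] [IsDomain R] {n : ℕ} (x y : Fin n → R)
    (hx : Function.Injective x) (G : Fin n → Fin n → R) (hG : ∀ i j, G i j * (1 - x i * y j) = 1) :
    (Matrix.of G).det = (Matrix.projVandermonde 1 x).det * (Matrix.projVandermonde 1 y).det *
      ∏ p : Fin n × Fin n, G p.1 p.2 := by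
  have h1 : (Matrix.of fun i j => ∏ k ∈ Finset.univ.erase i, (1 - x k * y j)) =
      Matrix.of fun i j => (∏ k, (1 - x k * y j)) * (Matrix.of G) i j := by
    ext i j
    simp only [Matrix.of_apply]
    rw [← Finset.mul_prod_erase _ _ (Finset.mem_univ i)]
    linear_combination (-(∏ k ∈ Finset.univ.erase i, (1 - x k * y j))) * hG i j
  have h2 := det_A x y hx
  rw [h1, Matrix.det_mul_row] at h2
  rw [← h2, mul_right_comm, Fintype.prod_prod_type_right, ← Finset.prod_mul_distrib]
  have : ∀ j, (∏ k, (1 - x k * y j)) * ∏ i, G i j = 1 := by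
    intro j
    rw [← Finset.prod_mul_distrib]
    apply Finset.prod_eq_one
    intro i _
    rw [mul_comm]; exact hG i j
  simp [this]

/-- geometric series -/
noncomputable def geom {σ : Type*} (m : σ →₀ ℕ) : MvPowerSeries σ ℤ :=
  fun d => if ∃ k : ℕ, d = k • m then 1 else 0

lemma coeff_geom {σ : Type*} (m d : σ →₀ ℕ) :
    MvPowerSeries.coeff d (geom m) = if ∃ k : ℕ, d = k • m then 1 else 0 := rfl

lemma geom_mul {σ : Type*} (m : σ →₀ ℕ) (hm : m ≠ 0) :
    geom m * (1 - MvPowerSeries.monomial m 1) = 1 := by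
  ext d
  rw [mul_comm, sub_mul, one_mul, map_sub, MvPowerSeries.coeff_monomial_mul, coeff_geom, coeff_geom,
    MvPowerSeries.coeff_one]
  by_cases h0 : d = 0
  · subst h0
    rw [if_pos ⟨0, by simp⟩, if_neg (by simpa using hm)]; simp
  · rw [if_neg h0]
    by_cases h : ∃ k : ℕ, d = k • m
    · rw [if_pos h]
      obtain ⟨k, rfl⟩ := h
      cases k with
      | zero => simp at h0
      | succ k =>
        rw [if_pos (by rw [succ_nsmul]; exact le_add_self), if_pos ⟨k, by rw [succ_nsmul]; simp⟩]
        simp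
    · rw [if_neg h]
      split_ifs with h1 h2
      · exfalso
        obtain ⟨k, hk⟩ := h2
        exact h ⟨k + 1, by rw [succ_nsmul, ← hk, tsub_add_cancel_of_le h1]⟩
      · simp
      · simp

lemma coeff_prod_geom {σ ι : Type*} [Fintype ι] (m : ι → σ →₀ ℕ) (hm : ∀ i, m i ≠ 0)
    (d : σ →₀ ℕ) :
    MvPowerSeries.coeff d (∏ i, geom (m i)) = (Nat.card {k : ι → ℕ // ∑ i, k i • m i = d} : ℤ) := by
  rw [MvPowerSeries.coeff_prod]
  have h1 : ∀ l : ι →₀ (σ →₀ ℕ), ∏ i, MvPowerSeries.coeff (l i) (geom (m i)) =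
      if (∀ i, ∃ k : ℕ, l i = k • m i) then (1 : ℤ) else 0 := by
    intro l
    simp only [coeff_geom]
    rw [Finset.prod_ite_zero]
    simp
  simp only [h1]
  rw [Finset.sum_boole]
  congr 1
  rw [← Nat.card_eq_finsetCard]
  symm
  have hinj : ∀ i (a b : ℕ), a • m i = b • m i → a = b := by
    intro i a b hab
    obtain ⟨s, hs⟩ := Finsupp.ne_iff.1 (hm i)
    have := DFunLike.congr_fun hab s
    simp only [Finsupp.smul_apply, smul_eq_mul] at this
    exact Nat.eq_of_mul_eq_mul_right (Nat.pos_of_ne_zero hs) this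
  apply Nat.card_eq_of_bijective (f := fun k : {k : ι → ℕ // ∑ i, k i • m i = d} =>
    (⟨Finsupp.equivFunOnFinite.symm (fun i => k.1 i • m i), by
      simp only [Finset.mem_filter, Finset.mem_finsuppAntidiag]
      refine ⟨⟨?_, by simp⟩, fun i => ⟨k.1 i, by simp⟩⟩
      simpa using k.2⟩ :
    {x : ι →₀ (σ →₀ ℕ) // x ∈ Finset.filter (fun x : ι →₀ (σ →₀ ℕ) =>
      ∀ (i : ι), ∃ k : ℕ, x i = k • m i) (Finset.univ.finsuppAntidiag d)}))
  constructor
  · intro a b hab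
    apply Subtype.ext
    funext i
    have := DFunLike.congr_fun (congrArg Subtype.val hab) i
    exact hinj i _ _ (by simpa using this)
  · rintro ⟨x, hx⟩
    simp only [Finset.mem_filter, Finset.mem_finsuppAntidiag] at hx
    choose k hk using hx.2
    refine ⟨⟨k, ?_⟩, ?_⟩
    · rw [← hx.1.1]; exact Finset.sum_congr rfl fun i _ => (hk i).symm
    · apply Subtype.ext
      ext1 i
      simp [hk i]

/-- fibre counts -/
noncomputable def cnt {n : ℕ} {ι : Type*} (F : Fin n → ι) (p : ι) : ℕ := Nat.card {x // F x = p}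

lemma cnt_eq_sum {n : ℕ} {ι : Type*} (F : Fin n → ι) (p : ι) :
    cnt F p = ∑ x, if F x = p then 1 else 0 := by
  unfold cnt
  rw [Nat.card_eq_fintype_card, Fintype.card_subtype]; simp

lemma cnt_comp {n : ℕ} {ι : Type*} (F : Fin n → ι) (g : Equiv.Perm (Fin n)) :
    cnt (F ∘ g) = cnt F := by
  funext p
  rw [cnt_eq_sum, cnt_eq_sum]
  exact Equiv.sum_comp g (fun x => if F x = p then 1 else 0)

lemma exists_perm {n : ℕ} {ι : Type*} (F F' : Fin n → ι) (h : cnt F = cnt F') :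
    ∃ g : Equiv.Perm (Fin n), F ∘ g = F' := by
  have : ∀ p, Nonempty ({x // F' x = p} ≃ {x // F x = p}) := fun p =>
    Finite.card_eq.1 (congrFun h p).symm
  have e := fun p => (this p).some
  refine ⟨(Equiv.sigmaFiberEquiv F').symm.trans ((Equiv.sigmaCongrRight e).trans
    (Equiv.sigmaFiberEquiv F)), ?_⟩
  funext x
  exact (e (F' x) ⟨x, rfl⟩).2

lemma exists_cnt {n : ℕ} {ι : Type*} [Fintype ι] (M : ι → ℕ) (h : ∑ p, M p = n) :
    ∃ F : Fin n → ι, cnt F = M := by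
  have e : (Σ p, Fin (M p)) ≃ Fin n := Fintype.equivOfCardEq (by simp [h])
  refine ⟨fun x => (e.symm x).1, ?_⟩
  funext p
  unfold cnt
  have e2 : {x // (e.symm x).1 = p} ≃ Fin (M p) :=
    (e.symm.subtypeEquiv (q := fun s => s.1 = p) (fun _ => Iff.rfl)).trans
      (Equiv.sigmaSubtype p)
  rw [Nat.card_congr e2]; simp

lemma card_pairs {n : ℕ} {ι : Type*} [Fintype ι] (T : (ι → ℕ) → Prop)
    (hT : ∀ M, T M → ∑ p, M p = n) :
    Nat.card {q : Equiv.Perm (Fin n) × (Fin n → ι) // q.2 ∘ q.1 = q.2 ∧ T (cnt q.2)} =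
      Nat.card {M // T M} * n.factorial := by
  choose F0 hF0 using fun M : {M // T M} => exists_cnt M.1 (hT M.1 M.2)
  have : ∀ F : {F : Fin n → ι // T (cnt F)}, ∃ g : Equiv.Perm (Fin n),
      F.1 ∘ g = F0 ⟨cnt F.1, F.2⟩ := fun F => exists_perm _ _ (hF0 ⟨cnt F.1, F.2⟩).symm
  choose k hk using this
  have hfac : n.factorial = Nat.card (Equiv.Perm (Fin n)) := by
    rw [Nat.card_eq_fintype_card, Fintype.card_perm, Fintype.card_fin]
  rw [hfac, ← Nat.card_prod]
  apply Nat.card_eq_of_bijective (f := fun q : {q : Equiv.Perm (Fin n) × (Fin n → ι) //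
      q.2 ∘ q.1 = q.2 ∧ T (cnt q.2)} =>
    ((⟨cnt q.1.2, q.2.2⟩ : {M // T M}), q.1.1 * k ⟨q.1.2, q.2.2⟩))
  constructor
  · rintro ⟨⟨g, F⟩, h1, h2⟩ ⟨⟨g', F'⟩, h1', h2'⟩ h
    simp only [Prod.mk.injEq] at h
    obtain ⟨ha, hb⟩ := h
    dsimp only at h1 h2 h1' h2'
    have e1 : F ∘ (g * k ⟨F, h2⟩ : Equiv.Perm (Fin n)) = F0 ⟨cnt F, h2⟩ := by
      rw [Equiv.Perm.coe_mul, ← Function.comp_assoc, h1, ← hk ⟨F, h2⟩]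
    have e2 : F' ∘ (g' * k ⟨F', h2'⟩ : Equiv.Perm (Fin n)) = F0 ⟨cnt F', h2'⟩ := by
      rw [Equiv.Perm.coe_mul, ← Function.comp_assoc, h1', ← hk ⟨F', h2'⟩]
    rw [← hb, ← ha, ← e1] at e2
    have hF : F' = F := (Equiv.surjective _).injective_comp_right e2
    subst hF
    have hg := mul_right_cancel hb
    subst hg
    rfl
  · rintro ⟨⟨M, hM⟩, g⟩
    have hc : cnt (F0 ⟨M, hM⟩ ∘ (g⁻¹ : Equiv.Perm (Fin n))) = M := by rw [cnt_comp, hF0]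
    have hc' : T (cnt (F0 ⟨M, hM⟩ ∘ (g⁻¹ : Equiv.Perm (Fin n)))) := by rw [hc]; exact hM
    refine ⟨⟨(g * (k ⟨_, hc'⟩)⁻¹, F0 ⟨M, hM⟩ ∘ (g⁻¹ : Equiv.Perm (Fin n))), ?_, hc'⟩, ?_⟩
    · have h3 := hk ⟨_, hc'⟩
      dsimp only at h3 ⊢
      have h4 : F0 ⟨cnt (F0 ⟨M, hM⟩ ∘ (g⁻¹ : Equiv.Perm (Fin n))), hc'⟩ = F0 ⟨M, hM⟩ := by
        congr 1; exact Subtype.ext hc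
      rw [h4] at h3
      generalize k ⟨_, hc'⟩ = κ at h3 ⊢
      funext x
      have h5 := congrFun h3 (κ⁻¹ x)
      simp only [Function.comp_apply, Equiv.Perm.coe_mul, Equiv.Perm.inv_def,
        Equiv.symm_apply_apply, Equiv.apply_symm_apply] at h5 ⊢
      exact h5.symm
    · refine Prod.ext (Subtype.ext hc) ?_
      simp

/-- exponent vectors -/
noncomputable def ex {n : ℕ} (a b : Fin n → ℕ) : (Fin n ⊕ Fin n) →₀ ℕ :=
  Finsupp.equivFunOnFinite.symm (Sum.elim a b)

@[simp] lemma ex_inl {n : ℕ} (a b : Fin n → ℕ) (i : Fin n) : ex a b (Sum.inl i) = a i := rfl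
@[simp] lemma ex_inr {n : ℕ} (a b : Fin n → ℕ) (i : Fin n) : ex a b (Sum.inr i) = b i := rfl

/-- exponent of `x_i y_j` -/
noncomputable def mm {n : ℕ} (p : Fin n × Fin n) : (Fin n ⊕ Fin n) →₀ ℕ :=
  Finsupp.single (Sum.inl p.1) 1 + Finsupp.single (Sum.inr p.2) 1

@[simp] lemma mm_inl {n : ℕ} (p : Fin n × Fin n) (i : Fin n) :
    mm p (Sum.inl i) = if p.1 = i then 1 else 0 := by
  simp [mm, Finsupp.single_apply]

@[simp] lemma mm_inr {n : ℕ} (p : Fin n × Fin n) (i : Fin n) :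
    mm p (Sum.inr i) = if p.2 = i then 1 else 0 := by
  simp [mm, Finsupp.single_apply]

lemma mm_ne {n : ℕ} (p : Fin n × Fin n) : mm p ≠ 0 := by
  intro h
  have := DFunLike.congr_fun h (Sum.inl p.1)
  simp at this

lemma ex_eq_iff {n : ℕ} (d : (Fin n ⊕ Fin n) →₀ ℕ) (a b : Fin n → ℕ) :
    d = ex a b ↔ (∀ i, d (Sum.inl i) = a i) ∧ (∀ i, d (Sum.inr i) = b i) := by
  rw [DFunLike.ext_iff, Sum.forall]; rfl

lemma margin_iff {n : ℕ} (M : Fin n × Fin n → ℕ) (a b : Fin n → ℕ) :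
    ∑ p, M p • mm p = ex a b ↔ (∀ i, ∑ j, M (i, j) = a i) ∧ (∀ j, ∑ i, M (i, j) = b j) := by
  rw [ex_eq_iff]
  simp only [Finsupp.finsetSum_apply, Finsupp.smul_apply, mm_inl, mm_inr]
  refine and_congr (forall_congr' fun i => ?_) (forall_congr' fun i => ?_)
  · rw [Fintype.sum_prod_type]; simp
  · rw [Fintype.sum_prod_type_right]; simp

lemma cnt_fst {n : ℕ} (F : Fin n → Fin n × Fin n) (i : Fin n) :
    ∑ j, cnt F (i, j) = cnt (fun x => (F x).1) i := by
  simp only [cnt_eq_sum]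
  rw [Finset.sum_comm]
  apply Finset.sum_congr rfl
  intro x _
  simp only [Prod.ext_iff, ite_and]
  simp

lemma cnt_snd {n : ℕ} (F : Fin n → Fin n × Fin n) (j : Fin n) :
    ∑ i, cnt F (i, j) = cnt (fun x => (F x).2) j := by
  simp only [cnt_eq_sum]
  rw [Finset.sum_comm]
  apply Finset.sum_congr rfl
  intro x _
  simp only [Prod.ext_iff, and_comm, ite_and]
  simp

lemma sum_young_nat {n : ℕ} (a b : Fin n → ℕ) (ha : ∑ i, a i = n) :
    ∑ g : Equiv.Perm (Fin n), youngCount n (fun i => (a i : ℤ)) g *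
      youngCount n (fun i => (b i : ℤ)) g =
      n.factorial * MvPowerSeries.coeff (ex a b) (∏ p : Fin n × Fin n, geom (mm p)) := by
  rw [coeff_prod_geom _ mm_ne]
  have hc := card_pairs (n := n) (fun M : Fin n × Fin n → ℕ => ∑ p, M p • mm p = ex a b) (by
    intro M hM
    rw [margin_iff] at hM
    rw [Fintype.sum_prod_type]
    exact (Finset.sum_congr rfl fun i _ => hM.1 i).trans ha)
  rw [mul_comm, ← Nat.cast_mul, ← hc]
  have hy : ∀ (a : Fin n → ℕ) (g : Equiv.Perm (Fin n)), youngCount n (fun i => (a i : ℤ)) g =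
      (Nat.card {f : Fin n → Fin n // f ∘ g = f ∧ ∀ i, cnt f i = a i} : ℤ) := by
    intro a g
    unfold youngCount
    rw [if_pos (fun i => Int.natCast_nonneg _)]
    rfl
  simp only [hy, ← Nat.cast_mul, ← Nat.card_prod]
  rw [← Nat.cast_sum, ← Nat.card_sigma]
  congr 1
  apply Nat.card_congr
  refine ⟨fun q => ⟨(q.1, fun x => (q.2.1.1 x, q.2.2.1 x)), ?_, ?_⟩,
    fun q => ⟨q.1.1, ⟨fun x => (q.1.2 x).1, ?_, ?_⟩, ⟨fun x => (q.1.2 x).2, ?_, ?_⟩⟩, ?_, ?_⟩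
  · funext x
    exact Prod.ext (congrFun q.2.1.2.1 x) (congrFun q.2.2.2.1 x)
  · rw [margin_iff]
    exact ⟨fun i => (cnt_fst _ i).trans (q.2.1.2.2 i), fun i => (cnt_snd _ i).trans (q.2.2.2.2 i)⟩
  · funext x
    exact congrArg Prod.fst (congrFun q.2.1 x)
  · have := q.2.2
    rw [margin_iff] at this
    exact fun i => (cnt_fst _ i).symm.trans (this.1 i)
  · funext x
    exact congrArg Prod.snd (congrFun q.2.1 x)
  · have := q.2.2
    rw [margin_iff] at this
    exact fun i => (cnt_snd _ i).symm.trans (this.2 i)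
  · intro q; rfl
  · intro q; rfl

lemma sum_young {n : ℕ} (a b : Fin n → ℤ) (ha : ∑ i, a i = n) :
    ∑ g : Equiv.Perm (Fin n), youngCount n a g * youngCount n b g =
      n.factorial * (if (∀ i, 0 ≤ a i) ∧ (∀ i, 0 ≤ b i) then
        MvPowerSeries.coeff (ex (fun i => (a i).toNat) (fun i => (b i).toNat))
          (∏ p : Fin n × Fin n, geom (mm p)) else 0) := by
  split_ifs with h
  · rw [← sum_young_nat]
    · simp only [Int.toNat_of_nonneg (h.1 _), Int.toNat_of_nonneg (h.2 _)]
    · zify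
      simp only [Int.toNat_of_nonneg (h.1 _), ha]
  · rw [mul_zero]
    apply Finset.sum_eq_zero
    intro g _
    unfold youngCount
    split_ifs <;> first | (exfalso; tauto) | simp

/-- shifted partition -/
def shift (n : ℕ) (l : Partition') (i : Fin n) : ℕ := l.1 i + (i.rev : ℕ)

lemma shift_strictAnti (n : ℕ) (l : Partition') : StrictAnti (shift n l) := by
  intro i j hij
  unfold shift
  have h1 : l.1 (j : ℕ) ≤ l.1 (i : ℕ) := l.2 (le_of_lt hij)
  have h2 : (j.rev : ℕ) < (i.rev : ℕ) := Fin.rev_lt_rev.2 hij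
  omega

lemma sum_shift (n : ℕ) (l m : Partition') :
    ∑ π : Equiv.Perm (Fin n), (Equiv.Perm.sign π : ℤ) *
      (if ∀ i, shift n l (π i) = shift n m i then 1 else 0) =
    if ∀ i : Fin n, l.1 i = m.1 i then 1 else 0 := by
  have key : ∀ π : Equiv.Perm (Fin n), (∀ i, shift n l (π i) = shift n m i) ↔
      (π = 1 ∧ ∀ i : Fin n, l.1 i = m.1 i) := by
    intro π
    constructor
    · intro h
      have hm : StrictMono π := by
        intro i j hij
        have := shift_strictAnti n m hij
        rw [← h i, ← h j] at this
        exact (shift_strictAnti n l).lt_iff_gt.1 this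
      have hπ : π = 1 := by
        let o : Fin n ≃o Fin n := hm.orderIsoOfSurjective π π.surjective
        have : o = OrderIso.refl _ := Subsingleton.elim _ _
        ext1 i
        have := DFunLike.congr_fun this i
        exact this
      subst hπ
      refine ⟨rfl, fun i => ?_⟩
      have := h i
      simpa [shift] using this
    · rintro ⟨rfl, h⟩ i
      simp [shift, h i]
  simp only [key, ite_and]
  rw [Finset.sum_eq_single 1]
  · simp
  · intro b _ hb; simp [hb]
  · simp

lemma det_pv {n : ℕ} {R : Type*} [CommRing R] (x : Fin n → R) :
    (Matrix.projVandermonde 1 x).det =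
      ∑ σ : Equiv.Perm (Fin n), ((Equiv.Perm.sign σ : ℤ) : R) * ∏ i, x i ^ ((σ i).rev : ℕ) := by
  rw [← Matrix.det_transpose, Matrix.det_apply']
  apply Finset.sum_congr rfl
  intro σ _
  simp [Matrix.projVandermonde_apply]

/-- variables -/
noncomputable def xv {n : ℕ} (i : Fin n) : MvPowerSeries (Fin n ⊕ Fin n) ℤ :=
  MvPowerSeries.X (Sum.inl i)
/-- variables -/
noncomputable def yv {n : ℕ} (i : Fin n) : MvPowerSeries (Fin n ⊕ Fin n) ℤ :=
  MvPowerSeries.X (Sum.inr i)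

lemma cauchy {n : ℕ} : (Matrix.of fun i j : Fin n => geom (mm (i, j))).det =
    (Matrix.projVandermonde 1 xv).det * (Matrix.projVandermonde 1 yv).det *
      ∏ p : Fin n × Fin n, geom (mm p) := by
  have : IsDomain (MvPowerSeries (Fin n ⊕ Fin n) ℤ) := NoZeroDivisors.to_isDomain _
  rw [det_G xv yv _ (fun i j => geom (mm (i, j)))]
  · intro i j
    have : xv i * yv j = MvPowerSeries.monomial (mm (i, j)) (1 : ℤ) := by
      unfold xv yv mm MvPowerSeries.X
      rw [MvPowerSeries.monomial_mul_monomial]; simp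
    rw [this]
    exact geom_mul _ (mm_ne _)
  · intro i j h
    unfold xv at h
    exact Sum.inl_injective (MvPowerSeries.X_inj.1 h)

lemma coeff_det {n : ℕ} (u v : Fin n → ℕ) :
    MvPowerSeries.coeff (ex u v) (Matrix.of fun i j : Fin n => geom (mm (i, j))).det =
      ∑ π : Equiv.Perm (Fin n), (Equiv.Perm.sign π : ℤ) *
        (if ∀ i, u (π i) = v i then 1 else 0) := by
  rw [Matrix.det_apply, map_sum]
  apply Finset.sum_congr rfl
  intro π _
  rw [Units.smul_def, map_zsmul, smul_eq_mul]
  congr 1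
  simp only [Matrix.of_apply]
  rw [coeff_prod_geom (fun i => mm (π i, i)) (fun i => mm_ne _)]
  have key : ∀ k : Fin n → ℕ, ∑ i, k i • mm (π i, i) = ex u v ↔
      (k = v ∧ ∀ i, u (π i) = v i) := by
    intro k
    rw [ex_eq_iff]
    simp only [Finsupp.finsetSum_apply, Finsupp.smul_apply, mm_inl, mm_inr]
    have h1 : ∀ i, ∑ x, k x • (if π x = i then 1 else 0) = k (π.symm i) := by
      intro i
      simp only [← Equiv.eq_symm_apply]; simp
    have h2 : ∀ i, ∑ x, k x • (if x = i then 1 else 0) = k i := by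
      intro i; simp
    simp only [h1, h2]
    constructor
    · rintro ⟨ha, hb⟩
      refine ⟨funext hb, fun i => ?_⟩
      rw [← ha, ← hb]; simp
    · rintro ⟨rfl, h⟩
      refine ⟨fun i => ?_, fun _ => rfl⟩
      rw [← h]; simp
  simp only [key]
  split_ifs with h
  · simp [h]
  · simp [h]

lemma prod_pow_eq {n : ℕ} (a b : Fin n → ℕ) :
    (∏ i, xv i ^ a i) * (∏ i, yv i ^ b i) = MvPowerSeries.monomial (ex a b) (1 : ℤ) := by
  have : ex a b = (∑ i, Finsupp.single (Sum.inl i) (a i)) +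
      (∑ i, Finsupp.single (Sum.inr i) (b i)) := by
    symm
    rw [ex_eq_iff]
    simp [Finsupp.finsetSum_apply, Finsupp.single_apply]
  rw [this]
  have hp : ∀ (s : Finset (Fin n)) (f : Fin n → (Fin n ⊕ Fin n) →₀ ℕ),
      MvPowerSeries.monomial (∑ i ∈ s, f i) (1 : ℤ) = ∏ i ∈ s, MvPowerSeries.monomial (f i) 1 := by
    intro s f
    induction s using Finset.induction_on with
    | empty => simp
    | insert i s hi ih =>
      rw [Finset.sum_insert hi, Finset.prod_insert hi, ← ih, MvPowerSeries.monomial_mul_monomial,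
        one_mul]
  rw [← one_mul (1 : ℤ), ← MvPowerSeries.monomial_mul_monomial, hp, hp]
  simp only [xv, yv, MvPowerSeries.X_pow_eq]

lemma ex_le {n : ℕ} (a b c d : Fin n → ℕ) : ex a b ≤ ex c d ↔ (∀ i, a i ≤ c i) ∧ (∀ i, b i ≤ d i) := by
  rw [Finsupp.le_def, Sum.forall]; rfl

lemma size_eq_sum (n : ℕ) (l : Partition') (h : size l = n) :
    (∀ i, n ≤ i → l.1 i = 0) ∧ ∑ i : Fin n, l.1 i = n := by
  have h0 : ∀ i, n ≤ i → l.1 i = 0 := by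
    intro i hi
    by_contra hne
    have hsub : Finset.range (i + 1) ⊆ l.1.support := by
      intro j hj
      rw [Finset.mem_range] at hj
      rw [Finsupp.mem_support_iff]
      have := l.2 (Nat.le_of_lt_succ hj)
      omega
    have h1 : (Finset.range (i + 1)).card ≤ size l := by
      refine (Finset.card_le_card hsub).trans ?_
      unfold size Finsupp.sum
      rw [Finset.card_eq_sum_ones]
      apply Finset.sum_le_sum
      intro j hj
      rw [Finsupp.mem_support_iff] at hj
      exact Nat.one_le_iff_ne_zero.2 hj
    simp at h1
    omega
  refine ⟨h0, ?_⟩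
  have : size l = ∑ i ∈ Finset.range n, l.1 i := by
    unfold size
    apply Finsupp.sum_of_support_subset
    · intro i hi
      rw [Finsupp.mem_support_iff] at hi
      rw [Finset.mem_range]
      by_contra hh
      exact hi (h0 i (by omega))
    · simp
  rw [← Finset.sum_range (fun i => l.1 i), ← this, h]

theorem irrChar_orth (n : ℕ) (l m : Partition') (hl : size l = n) (hm : size m = n) :
    ∑ g : Equiv.Perm (Fin n), irrChar n l g * irrChar n m g =
      n.factorial * (if l = m then 1 else 0) := by
  have hlm : l = m ↔ ∀ i : Fin n, l.1 i = m.1 i := by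
    constructor
    · rintro rfl i; rfl
    · intro h
      apply Subtype.ext
      ext i
      by_cases hi : i < n
      · exact h ⟨i, hi⟩
      · rw [(size_eq_sum n l hl).1 i (by omega), (size_eq_sum n m hm).1 i (by omega)]
  have e1 : ∑ g : Equiv.Perm (Fin n), irrChar n l g * irrChar n m g =
      ∑ σ : Equiv.Perm (Fin n), ∑ τ : Equiv.Perm (Fin n),
        (Equiv.Perm.sign σ : ℤ) * (Equiv.Perm.sign τ : ℤ) *
        ∑ g : Equiv.Perm (Fin n),
          youngCount n (fun i => (l.1 i : ℤ) + ((σ i : ℕ) : ℤ) - (i : ℤ)) g *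
          youngCount n (fun i => (m.1 i : ℤ) + ((τ i : ℕ) : ℤ) - (i : ℤ)) g := by
    simp only [irrChar, Finset.sum_mul_sum]
    simp only [Finset.mul_sum]
    rw [Finset.sum_comm]
    apply Finset.sum_congr rfl; intro σ _
    rw [Finset.sum_comm]
    apply Finset.sum_congr rfl; intro τ _
    apply Finset.sum_congr rfl; intro g _
    ring
  have e2 := congrArg (MvPowerSeries.coeff (ex (shift n l) (shift n m))) (cauchy (n := n))
  rw [coeff_det, sum_shift, det_pv, det_pv] at e2
  simp only [hlm]
  rw [e1, e2, Finset.sum_mul_sum, Finset.sum_mul, map_sum, Finset.mul_sum]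
  apply Finset.sum_congr rfl; intro σ _
  rw [Finset.sum_mul, map_sum, Finset.mul_sum]
  apply Finset.sum_congr rfl; intro τ _
  rw [sum_young]
  · have e3 : ∀ F : MvPowerSeries (Fin n ⊕ Fin n) ℤ,
      ((Equiv.Perm.sign σ : ℤ) : MvPowerSeries (Fin n ⊕ Fin n) ℤ) *
        (∏ i, xv i ^ ((σ i).rev : ℕ)) *
        (((Equiv.Perm.sign τ : ℤ) : MvPowerSeries (Fin n ⊕ Fin n) ℤ) *
        (∏ i, yv i ^ ((τ i).rev : ℕ))) * F =
        ((Equiv.Perm.sign σ : ℤ) * (Equiv.Perm.sign τ : ℤ)) •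
        (MvPowerSeries.monomial (ex (fun i => ((σ i).rev : ℕ)) (fun i => ((τ i).rev : ℕ))) (1 : ℤ)
          * F) := by
      intro F
      rw [← prod_pow_eq, zsmul_eq_mul]
      push_cast
      ring
    rw [e3, map_zsmul, MvPowerSeries.coeff_monomial_mul, smul_eq_mul, one_mul, mul_left_comm]
    congr 2
    have hr : ∀ (l : Partition') (σ : Equiv.Perm (Fin n)) (i : Fin n),
        (l.1 i : ℤ) + ((σ i : ℕ) : ℤ) - (i : ℤ) = (shift n l i : ℤ) - ((σ i).rev : ℕ) := by
      intro l σ i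
      unfold shift
      simp only [Fin.val_rev]
      have := (σ i).2
      have := i.2
      omega
    simp only [hr]
    have hd : ex (shift n l) (shift n m) -
        ex (fun i => ((σ i).rev : ℕ)) (fun i => ((τ i).rev : ℕ)) =
        ex (fun i => ((shift n l i : ℤ) - ((σ i).rev : ℕ)).toNat)
          (fun i => ((shift n m i : ℤ) - ((τ i).rev : ℕ)).toNat) := by
      rw [ex_eq_iff]
      simp only [Finsupp.tsub_apply, ex_inl, ex_inr]
      constructor <;> intro i <;> omega
    rw [hd]
    refine if_congr ?_ rfl rfl
    simp only [ex_le, sub_nonneg, Nat.cast_le]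
  · have hs : ∑ i : Fin n, ((σ i : ℕ) : ℤ) = ∑ i : Fin n, ((i : ℕ) : ℤ) :=
      Equiv.sum_comp σ (fun i => ((i : ℕ) : ℤ))
    rw [Finset.sum_sub_distrib, Finset.sum_add_distrib, hs, add_sub_cancel_right, ← Nat.cast_sum,
      (size_eq_sum n l hl).2]

lemma irrChar_cast {n n' : ℕ} (e : n = n') (nu : Partition') (g : Equiv.Perm (Fin n)) :
    irrChar n' nu ((finCongr e).permCongr g) = irrChar n nu g := by
  subst e
  congr 1

lemma irrChar_zero (l : Partition') (g : Equiv.Perm (Fin 0)) : irrChar 0 l g = 1 := by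
  unfold irrChar youngCount
  have h2 : Fintype.card {f : Fin 0 → Fin 0 // f ∘ g = f} = 1 :=
    Fintype.card_eq_one_iff.2 ⟨⟨id, Subsingleton.elim _ _⟩,
      fun f => Subtype.ext (Subsingleton.elim _ _)⟩
  simp [h2]

lemma sumEmb_right {a : ℕ} (g : Equiv.Perm (Fin a)) (h : Equiv.Perm (Fin 0)) :
    sumEmb g h = (finCongr (Nat.add_zero a).symm).permCongr g := by
  ext x
  obtain ⟨x, rfl⟩ := finSumFinEquiv.surjective x
  rcases x with x | x
  · simp only [sumEmb, Equiv.permCongr_apply, Equiv.symm_apply_apply]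
    simp
    rfl
  · exact x.elim0

lemma sumEmb_left {a : ℕ} (g : Equiv.Perm (Fin a)) (h : Equiv.Perm (Fin 0)) :
    sumEmb h g = (finCongr (Nat.zero_add a).symm).permCongr g := by
  ext x
  obtain ⟨x, rfl⟩ := finSumFinEquiv.surjective x
  rcases x with x | x
  · exact x.elim0
  · simp only [sumEmb, Equiv.permCongr_apply, Equiv.symm_apply_apply]
    have : (finCongr (Nat.zero_add a).symm).symm (finSumFinEquiv (Sum.inr x)) = x := by
      ext; simp
    rw [this]
    simp

lemma lrsum_right (a b : ℕ) (hb : b = 0) (l β nu : Partition') (hl : size l = a)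
    (hnu : size nu = a) :
    ∑ g : Equiv.Perm (Fin a), ∑ h : Equiv.Perm (Fin b),
        irrChar a l g * irrChar b β h * irrChar (a + b) nu (sumEmb g h) =
      a.factorial * (if l = nu then 1 else 0) := by
  subst hb
  rw [← irrChar_orth a l nu hl hnu]
  apply Finset.sum_congr rfl; intro g _
  simp only [irrChar_zero, sumEmb_right, irrChar_cast]
  simp

lemma lrsum_left (a b : ℕ) (hb : b = 0) (l β nu : Partition') (hl : size l = a)
    (hnu : size nu = a) :
    ∑ h : Equiv.Perm (Fin b), ∑ g : Equiv.Perm (Fin a),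
        irrChar b β h * irrChar a l g * irrChar (b + a) nu (sumEmb h g) =
      a.factorial * (if l = nu then 1 else 0) := by
  subst hb
  rw [← irrChar_orth a l nu hl hnu]
  simp only [irrChar_zero, sumEmb_left, irrChar_cast]
  simp

lemma size_zero : size (row 0) = 0 := by
  simp [size, row]

lemma eq_row_zero (l : Partition') (h : size l = 0) : l = row 0 := by
  apply Subtype.ext
  ext i
  rw [(size_eq_sum 0 l h).1 i (Nat.zero_le _)]
  simp [row]

lemma lr_size (l m nu : Partition') (h : size nu ≠ size l + size m) : lr l m nu = 0 := by
  unfold lr; rw [if_neg h]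

lemma lr_right (l nu : Partition') : lr l (row 0) nu = if l = nu then 1 else 0 := by
  unfold lr
  split_ifs with h h2 h2
  · rw [lrsum_right _ _ size_zero l _ nu rfl (by rw [h, size_zero, add_zero]), if_pos h2, size_zero]
    simp [Nat.factorial_ne_zero]
  · rw [lrsum_right _ _ size_zero l _ nu rfl (by rw [h, size_zero, add_zero]), if_neg h2]
    simp
  · subst h2; rw [size_zero] at h; simp at h
  · rfl

lemma lr_left (l nu : Partition') : lr (row 0) l nu = if l = nu then 1 else 0 := by
  unfold lr
  split_ifs with h h2 h2
  · rw [lrsum_left _ _ size_zero l _ nu rfl (by rw [h, size_zero, zero_add]), if_pos h2, size_zero]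
    simp [Nat.factorial_ne_zero]
  · rw [lrsum_left _ _ size_zero l _ nu rfl (by rw [h, size_zero, zero_add]), if_neg h2]
    simp
  · subst h2; rw [size_zero] at h; simp at h
  · rfl

lemma kron_zero_aux (k : ℕ) (hk : k = 0) (l m nu : Partition') :
    ((∑ g : Equiv.Perm (Fin k), irrChar k l g * irrChar k m g * irrChar k nu g) /
      (Nat.factorial k : ℤ)).toNat = 1 := by
  subst hk
  simp [irrChar_zero]

lemma kron_zero : kron (row 0) (row 0) (row 0) = 1 := by
  unfold kron
  rw [if_pos ⟨rfl, rfl⟩]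
  exact kron_zero_aux _ size_zero _ _ _

lemma term_eq (l m nu : Partition') (h : size nu = size l + size m) (α β δ η ρ τ : Partition') :
    lr α β l * lr η ρ m * kron β η δ * lr α δ τ * lr τ ρ nu =
      if α = l ∧ β = row 0 ∧ δ = row 0 ∧ η = row 0 ∧ ρ = m ∧ τ = l then lr l m nu else 0 := by
  split_ifs with hc
  · obtain ⟨rfl, rfl, rfl, rfl, rfl, rfl⟩ := hc
    simp [lr_right, lr_left, kron_zero]
  · by_contra hne
    simp only [mul_eq_zero, not_or] at hne
    obtain ⟨⟨⟨⟨h1, h2⟩, h3⟩, h4⟩, h5⟩ := hne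
    have s1 : size l = size α + size β := by by_contra hh; exact h1 (lr_size _ _ _ hh)
    have s2 : size m = size η + size ρ := by by_contra hh; exact h2 (lr_size _ _ _ hh)
    have s4 : size τ = size α + size δ := by by_contra hh; exact h4 (lr_size _ _ _ hh)
    have s5 : size nu = size τ + size ρ := by by_contra hh; exact h5 (lr_size _ _ _ hh)
    have s3 : size β = size δ ∧ size η = size δ := by
      by_contra hh; apply h3; unfold kron; rw [if_neg hh]
    have hβ := eq_row_zero β (by omega)
    have hδ := eq_row_zero δ (by omega)
    have hη := eq_row_zero η (by omega)
    subst hβ hδ hη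
    rw [lr_right] at h1 h4
    rw [lr_left] at h2
    simp only [ite_eq_right_iff, one_ne_zero, imp_false, not_not] at h1 h2 h4
    subst h1 h2 h4
    simp at hc

end Partition'

open Partition' in
/-- For partitions `λ, μ` and `ν` with `|ν| = |λ| + |μ|`, the Aguiar coefficient
`a_{λ,μ}^ν` (the sextuple sum `Σ c_{α,β}^λ c_{η,ρ}^μ g_{β,η,δ} c_{α,δ}^τ c_{τ,ρ}^ν`)
equals the Littlewood–Richardson coefficient `c_{λ,μ}^ν`. -/
theorem aguiar_top_eq_lr (l m nu : Partition') (h : size nu = size l + size m) :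
    aguiar l m nu = lr l m nu := by
  unfold aguiar
  simp only [term_eq l m nu h]
  rw [finsum_eq_single _ l (by intro x hx; simp [hx])]
  rw [finsum_eq_single _ (row 0) (by intro x hx; simp [hx])]
  rw [finsum_eq_single _ (row 0) (by intro x hx; simp [hx])]
  rw [finsum_eq_single _ (row 0) (by intro x hx; simp [hx])]
  rw [finsum_eq_single _ m (by intro x hx; simp [hx])]
  rw [finsum_eq_single _ l (by intro x hx; simp [hx])]
  simp
end
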